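/- There is a universal constant C > 0 such that for all p, q with p* ∈ [2,4) and q ∈ [2,4), all a, b ∈ (0,1], all positive integers m, n, and every real m×n matrix A = (a_{ij}): E sup_{s ∈ B_{q*}^m ∩ a·B_∞^m} sup_{t ∈ B_p^n ∩ b·B_∞^n} Σ_{i≤m, j≤n} a_{ij} g_{ij} s_i t_j ≤ C·[ D1 + D2 + ( a^{(2−q*)/2}·Log^{2/(4−p*)}(m·a^{q*}) + b^{(2−p)/2}·Log^{2/(4−q)}(n·b^{p}) )·max_{i,j} |a_{ij}| ]. -/

import Mathlib

open MeasureTheory ProbabilityTheory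
open scoped ENNReal NNReal

noncomputable section

/-- The `ℓ_r` norm of a finite real vector, `r ∈ [1,∞]`. -/
def lpNorm (r : ℝ≥0∞) {ι : Type*} [Fintype ι] (x : ι → ℝ) : ℝ :=
  if r = ⊤ then ⨆ i, |x i| else (∑ i, |x i| ^ r.toReal) ^ (1 / r.toReal)

/-- The operator norm `‖M‖_{p→q}` expressed via the conjugate exponent `q*`:
the supremum of the bilinear form over `s` in the unit ball of `ℓ_{q*}` and
`t` in the unit ball of `ℓ_p`. -/
def opNorm (p qstar : ℝ≥0∞) {ι κ : Type*} [Fintype ι] [Fintype κ]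
    (M : ι → κ → ℝ) : ℝ :=
  sSup { x : ℝ | ∃ s : ι → ℝ, ∃ t : κ → ℝ,
    lpNorm qstar s ≤ 1 ∧ lpNorm p t ≤ 1 ∧ x = ∑ i, ∑ j, M i j * s i * t j }

/-- The standard Gaussian product measure on `ι → ℝ` (iid `N(0,1)` coordinates). -/
def stdGaussian (ι : Type*) [Fintype ι] : Measure (ι → ℝ) :=
  Measure.pi fun _ => gaussianReal 0 1

/-- `Log x = max 1 (ln x)`; in particular `Log 0 = 1`. -/
def Log (x : ℝ) : ℝ := max 1 (Real.log x)

/-- `E‖G_A‖_{p→q}` for the Gaussian matrix `G_A = (a_{ij} g_{ij})`. -/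
def EopNorm (p qstar : ℝ≥0∞) {m n : ℕ} (A : Fin m → Fin n → ℝ) : ℝ :=
  ∫ g : Fin m × Fin n → ℝ,
    opNorm p qstar (fun i j => A i j * g (i, j)) ∂ stdGaussian (Fin m × Fin n)

/-- `D1 = max_i ‖(a_{ij})_j‖_{p*}`. -/
def D1 (pstar : ℝ≥0∞) {m n : ℕ} (A : Fin m → Fin n → ℝ) : ℝ :=
  ⨆ i, lpNorm pstar (fun j => A i j)

/-- `D2 = max_j ‖(a_{ij})_i‖_q`. -/
def D2 (q : ℝ≥0∞) {m n : ℕ} (A : Fin m → Fin n → ℝ) : ℝ :=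
  ⨆ j, lpNorm q (fun i => A i j)

/-- `max_{i,j} |a_{ij}|`. -/
def maxEntry {m n : ℕ} (A : Fin m → Fin n → ℝ) : ℝ :=
  ⨆ ij : Fin m × Fin n, |A ij.1 ij.2|

/-- `max_{k ≥ 0} inf_{I ⊂ [m]×[n], |I| = k} √(Log k) · max_{(i,j) ∉ I} |a_{ij}|`
(for `k > mn` the term vanishes, so `k` ranges over `0,…,mn`). -/
def Dinf {m n : ℕ} (A : Fin m → Fin n → ℝ) : ℝ :=
  ⨆ k : Fin (m * n + 1),
    ⨅ I : { I : Finset (Fin m × Fin n) // I.card = k.1 },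
      Real.sqrt (Log (k.1 : ℝ)) *
        ⨆ ij : { ij : Fin m × Fin n // ij ∉ I.1 }, |A ij.1.1 ij.1.2|

/-- `E max_{i,j} |a_{ij} g_{ij}|`. -/
def EmaxGauss {m n : ℕ} (A : Fin m → Fin n → ℝ) : ℝ :=
  ∫ g : Fin m × Fin n → ℝ,
    (⨆ ij : Fin m × Fin n, |A ij.1 ij.2 * g ij|) ∂ stdGaussian (Fin m × Fin n)

instance isProbabilityMeasure_stdGaussian (ι : Type*) [Fintype ι] :
    IsProbabilityMeasure (stdGaussian ι) := by
  unfold _root_.stdGaussian; infer_instance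

/-- Stein's identity for a bounded function with bounded derivative. -/
lemma integral_id_mul_gaussianReal {φ φ' : ℝ → ℝ} (hφ : ∀ x, HasDerivAt φ (φ' x) x)
    {C : ℝ} (hb : ∀ x, |φ x| ≤ C) (hb' : ∀ x, |φ' x| ≤ C) :
    ∫ x, x * φ x ∂(gaussianReal 0 1) = ∫ x, φ' x ∂(gaussianReal 0 1) := by
  have hφc : Continuous φ := continuous_iff_continuousAt.2 fun x => (hφ x).continuousAt
  have hφ'm : Measurable φ' := by
    have : φ' = deriv φ := funext fun x => (hφ x).deriv.symm
    rw [this]; exact measurable_deriv φ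
  set e : ℝ → ℝ := fun x => Real.exp (-(1 / 2) * x ^ 2) with he
  have hpdf : ∀ x, gaussianPDFReal 0 1 x = (√(2 * Real.pi))⁻¹ * e x := by
    intro x; simp only [gaussianPDFReal, he]; simp; left; ring
  have hei : Integrable e := integrable_exp_neg_mul_sq (by norm_num)
  have hxei : Integrable (fun x => x * e x) := integrable_mul_exp_neg_mul_sq (by norm_num)
  have hde : ∀ x, HasDerivAt e (-(x * e x)) x := by
    intro x
    have := ((hasDerivAt_pow 2 x).const_mul (-(1 / 2 : ℝ))).exp
    convert this using 1
    simp only [he]; push_cast; ring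
  have h1 : Integrable (fun x => φ x * e x) :=
    hei.bdd_mul hφc.aestronglyMeasurable (Filter.Eventually.of_forall hb)
  have h2 : Integrable (fun x => φ' x * e x) :=
    hei.bdd_mul hφ'm.aestronglyMeasurable (Filter.Eventually.of_forall hb')
  have h3 : Integrable (fun x => φ x * (x * e x)) :=
    hxei.bdd_mul hφc.aestronglyMeasurable (Filter.Eventually.of_forall hb)
  have h4 : ∫ x, (φ' x * e x + φ x * (-(x * e x))) = 0 := by
    refine integral_eq_zero_of_hasDerivAt_of_integrable
      (fun x => (hφ x).mul (hde x)) ?_ h1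
    simpa [mul_neg, ← sub_eq_add_neg] using! h2.sub h3
  have h5 : ∫ x, φ' x * e x = ∫ x, φ x * (x * e x) := by
    simp only [mul_neg, ← sub_eq_add_neg] at h4
    rw [integral_sub h2 h3] at h4
    linarith
  rw [integral_gaussianReal_eq_integral_smul one_ne_zero,
    integral_gaussianReal_eq_integral_smul one_ne_zero]
  simp only [hpdf, smul_eq_mul, mul_assoc, integral_const_mul]
  congr 1
  calc _ = ∫ x, φ x * (x * e x) := by congr 1; ext x; ring
    _ = _ := by rw [← h5]; congr 1; ext x; ring

lemma measurePreserving_update_stdGaussian {ι : Type*} [Fintype ι] [DecidableEq ι] (l : ι) :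
    MeasurePreserving (fun z : ℝ × (ι → ℝ) => Function.update z.2 l z.1)
      ((gaussianReal 0 1).prod (stdGaussian ι)) (stdGaussian ι) := by
  have hm : Measurable (fun z : ℝ × (ι → ℝ) => Function.update z.2 l z.1) := by
    refine measurable_pi_iff.2 fun i => ?_
    by_cases h : i = l
    · subst h; simpa using measurable_fst
    · simp only [Function.update_of_ne h]
      exact (measurable_pi_apply i).comp measurable_snd
  refine ⟨hm, ?_⟩
  symm
  refine Measure.pi_eq fun s hs => ?_
  rw [Measure.map_apply hm (MeasurableSet.univ_pi hs)]
  have : (fun z : ℝ × (ι → ℝ) => Function.update z.2 l z.1) ⁻¹' Set.univ.pi s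
      = s l ×ˢ Set.univ.pi (Function.update s l Set.univ) := by
    ext ⟨x, g⟩
    simp only [Set.mem_preimage, Set.mem_pi, Set.mem_univ, true_imp_iff, Set.mem_prod]
    constructor
    · intro h
      refine ⟨by simpa using h l, fun i => ?_⟩
      by_cases hi : i = l
      · subst hi; simp
      · simpa [Function.update_of_ne hi] using h i
    · rintro ⟨h1, h2⟩ i
      by_cases hi : i = l
      · subst hi; simpa using h1
      · simpa [Function.update_of_ne hi] using h2 i
  rw [this, Measure.prod_prod, _root_.stdGaussian, Measure.pi_pi,
    ← Finset.mul_prod_erase _ _ (Finset.mem_univ l),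
    ← Finset.mul_prod_erase _ (fun i => gaussianReal 0 1 (s i)) (Finset.mem_univ l)]
  simp only [Function.update_self, measure_univ, one_mul]
  congr 1
  refine Finset.prod_congr rfl fun i hi => ?_
  rw [Function.update_of_ne (Finset.ne_of_mem_erase hi)]

lemma integrable_eval_stdGaussian {ι : Type*} [Fintype ι] (l : ι) {f : ℝ → ℝ}
    (hf : Integrable f (gaussianReal 0 1)) :
    Integrable (fun g : ι → ℝ => f (g l)) (stdGaussian ι) :=
  (measurePreserving_eval (fun _ : ι => gaussianReal 0 1) l).integrable_comp_of_integrable hf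

lemma integrable_coord_stdGaussian {ι : Type*} [Fintype ι] (l : ι) :
    Integrable (fun g : ι → ℝ => g l) (stdGaussian ι) := by
  have := (memLp_id_gaussianReal (μ := 0) (v := 1) 1).integrable (by norm_num)
  exact integrable_eval_stdGaussian l this

/-- Gaussian integration by parts in one coordinate. -/
lemma integral_coord_mul_stdGaussian {ι : Type*} [Fintype ι] [DecidableEq ι] (l : ι)
    {φ φ' : (ι → ℝ) → ℝ} (hφm : Measurable φ) (hφ'm : Measurable φ')
    (hφ : ∀ g, HasDerivAt (fun x => φ (Function.update g l x)) (φ' g) (g l))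
    {C : ℝ} (hb : ∀ g, |φ g| ≤ C) (hb' : ∀ g, |φ' g| ≤ C) :
    ∫ g, g l * φ g ∂(stdGaussian ι) = ∫ g, φ' g ∂(stdGaussian ι) := by
  have mp := measurePreserving_update_stdGaussian l
  have i1 : Integrable (fun g : ι → ℝ => g l * φ g) (stdGaussian ι) :=
    (integrable_coord_stdGaussian l).mul_bdd hφm.aestronglyMeasurable
      (Filter.Eventually.of_forall hb)
  have i2 : Integrable φ' (stdGaussian ι) :=
    Integrable.of_bound hφ'm.aestronglyMeasurable C (Filter.Eventually.of_forall hb')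
  have e1 := mp.integrable_comp_of_integrable i1
  have e2 := mp.integrable_comp_of_integrable i2
  rw [← mp.map_eq, integral_map mp.aemeasurable (by rw [mp.map_eq]; exact i1.1),
    integral_map mp.aemeasurable (by rw [mp.map_eq]; exact i2.1)]
  refine (integral_prod_symm _ e1).trans (Eq.trans ?_ (integral_prod_symm _ e2).symm)
  simp only [Function.comp_def]
  congr 1
  ext g
  simp only [Function.update_self]
  refine integral_id_mul_gaussianReal (C := C) (fun x => ?_) (fun x => hb _) (fun x => hb' _)
  simpa using hφ (Function.update g l x)

section SudakovFernique

variable {τ ι : Type*} [Fintype τ] [Fintype ι]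

/-- The log-sum-exp function. -/
def logSumExp (z : τ → ℝ) : ℝ := Real.log (∑ t, Real.exp (z t))

/-- The Gibbs weights, i.e. the gradient of `logSumExp`. -/
def gibbs (z : τ → ℝ) (t : τ) : ℝ := Real.exp (z t) / ∑ u, Real.exp (z u)

lemma le_logSumExp (z : τ → ℝ) (t : τ) : z t ≤ logSumExp z := by
  unfold logSumExp
  rw [Real.le_log_iff_exp_le (Finset.sum_pos (fun _ _ => Real.exp_pos _) ⟨t, Finset.mem_univ t⟩)]
  exact Finset.single_le_sum (f := fun t => Real.exp (z t)) (fun _ _ => (Real.exp_pos _).le)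
    (Finset.mem_univ t)

lemma logSumExp_le [Nonempty τ] {z : τ → ℝ} {c : ℝ} (h : ∀ t, z t ≤ c) :
    logSumExp z ≤ c + Real.log (Fintype.card τ) := by
  have hc : (0 : ℝ) < Fintype.card τ := by exact_mod_cast Fintype.card_pos
  have : ∑ t, Real.exp (z t) ≤ Fintype.card τ * Real.exp c := by
    calc _ ≤ ∑ _t : τ, Real.exp c := Finset.sum_le_sum fun t _ => Real.exp_le_exp.2 (h t)
      _ = _ := by simp
  calc _ ≤ Real.log (Fintype.card τ * Real.exp c) := Real.log_le_log
        (Finset.sum_pos (fun _ _ => Real.exp_pos _) Finset.univ_nonempty) this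
    _ = _ := by rw [Real.log_mul hc.ne' (Real.exp_pos c).ne', Real.log_exp, add_comm]

lemma abs_logSumExp_le [Nonempty τ] (z : τ → ℝ) :
    |logSumExp z| ≤ ∑ t, |z t| + Real.log (Fintype.card τ) := by
  have hz : ∀ t, |z t| ≤ ∑ t, |z t| := fun t =>
    Finset.single_le_sum (f := fun t => |z t|) (fun _ _ => abs_nonneg _) (Finset.mem_univ t)
  have hl : 0 ≤ Real.log (Fintype.card τ) := Real.log_natCast_nonneg _
  rw [abs_le]
  constructor
  · have t : τ := Classical.arbitrary τ
    have := le_logSumExp z t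
    have := neg_abs_le (z t)
    linarith [hz t]
  · exact logSumExp_le fun t => (le_abs_self _).trans (hz t)

lemma gibbs_nonneg (z : τ → ℝ) (t : τ) : 0 ≤ gibbs z t :=
  div_nonneg (Real.exp_pos _).le (Finset.sum_nonneg fun _ _ => (Real.exp_pos _).le)

lemma sum_gibbs [Nonempty τ] (z : τ → ℝ) : ∑ t, gibbs z t = 1 := by
  unfold gibbs
  rw [← Finset.sum_div, div_self]
  exact (Finset.sum_pos (fun _ _ => Real.exp_pos _) Finset.univ_nonempty).ne'

lemma gibbs_le_one (z : τ → ℝ) (t : τ) : gibbs z t ≤ 1 := by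
  have : Nonempty τ := ⟨t⟩
  rw [← sum_gibbs z]
  exact Finset.single_le_sum (fun t _ => gibbs_nonneg z t) (Finset.mem_univ t)

lemma hasDerivAt_logSumExp [Nonempty τ] {z : ℝ → τ → ℝ} {z' : τ → ℝ} {θ : ℝ}
    (h : ∀ t, HasDerivAt (fun x => z x t) (z' t) θ) :
    HasDerivAt (fun x => logSumExp (z x)) (∑ t, gibbs (z θ) t * z' t) θ := by
  have hpos : 0 < ∑ t, Real.exp (z θ t) :=
    Finset.sum_pos (fun _ _ => Real.exp_pos _) Finset.univ_nonempty
  have := (HasDerivAt.fun_sum (u := Finset.univ) fun t _ => (h t).exp).log hpos.ne'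
  refine this.congr_deriv ?_
  rw [Finset.sum_div]
  refine Finset.sum_congr rfl fun t _ => ?_
  unfold gibbs; ring

lemma hasDerivAt_gibbs [Nonempty τ] {z : ℝ → τ → ℝ} {z' : τ → ℝ} {θ : ℝ}
    (h : ∀ t, HasDerivAt (fun x => z x t) (z' t) θ) (t : τ) :
    HasDerivAt (fun x => gibbs (z x) t)
      (gibbs (z θ) t * (z' t - ∑ u, gibbs (z θ) u * z' u)) θ := by
  have hpos : 0 < ∑ t, Real.exp (z θ t) :=
    Finset.sum_pos (fun _ _ => Real.exp_pos _) Finset.univ_nonempty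
  have := (h t).exp.div (HasDerivAt.fun_sum (u := Finset.univ) fun t _ => (h t).exp) hpos.ne'
  refine this.congr_deriv ?_
  have e : ∑ u, gibbs (z θ) u * z' u
      = (∑ u, Real.exp (z θ u) * z' u) / ∑ u, Real.exp (z θ u) := by
    rw [Finset.sum_div]
    refine Finset.sum_congr rfl fun t _ => ?_
    unfold gibbs; ring
  rw [e]
  unfold gibbs
  field_simp

/-- The linear process `t ↦ ⟨x t, g⟩`. -/
def linProc {τ : Type*} (x : τ → ι → ℝ) (g : ι → ℝ) (t : τ) : ℝ := ∑ l, x t l * g l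

lemma abs_linProc_le {τ : Type*} (x : τ → ι → ℝ) (g : ι → ℝ) (t : τ) {B : ℝ} (hB : ∀ l, |x t l| ≤ B) :
    |linProc x g t| ≤ ∑ l, B * |g l| := by
  refine (Finset.abs_sum_le_sum_abs _ _).trans (Finset.sum_le_sum fun l _ => ?_)
  rw [abs_mul]
  exact mul_le_mul_of_nonneg_right (hB l) (abs_nonneg _)

@[fun_prop]
lemma continuous_linProc {τ : Type*} (x : τ → ι → ℝ) (t : τ) : Continuous fun g => linProc x g t := by
  unfold linProc; fun_prop

lemma continuous_logSumExp_linProc [Nonempty τ] (x : τ → ι → ℝ) :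
    Continuous fun g => logSumExp (linProc x g) := by
  unfold logSumExp
  refine Continuous.log (by fun_prop) fun g => ?_
  exact (Finset.sum_pos (fun _ _ => Real.exp_pos _) Finset.univ_nonempty).ne'

lemma continuous_gibbs_linProc [Nonempty τ] (x : τ → ι → ℝ) (t : τ) :
    Continuous fun g => gibbs (linProc x g) t := by
  unfold gibbs
  refine Continuous.div (by fun_prop) (by fun_prop) fun g => ?_
  exact (Finset.sum_pos (fun _ _ => Real.exp_pos _) Finset.univ_nonempty).ne'

lemma integrable_logSumExp_linProc [Nonempty τ] (x : τ → ι → ℝ) :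
    Integrable (fun g => logSumExp (linProc x g)) (stdGaussian ι) := by
  have hi : Integrable (fun g => ∑ t, |linProc x g t| + Real.log (Fintype.card τ))
      (stdGaussian ι) := by
    refine Integrable.add (integrable_finsetSum _ fun t _ => Integrable.abs ?_)
      (integrable_const _)
    exact integrable_finsetSum _ fun l _ => (integrable_coord_stdGaussian l).const_mul _
  exact hi.mono' (continuous_logSumExp_linProc x).aestronglyMeasurable
    (Filter.Eventually.of_forall fun g => abs_logSumExp_le _)

lemma integral_coord_mul_gibbs [Nonempty τ] (z : τ → ι → ℝ) (t : τ) (l : ι) :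
    ∫ g, g l * gibbs (linProc z g) t ∂(stdGaussian ι) =
      ∫ g, gibbs (linProc z g) t * (z t l - ∑ u, gibbs (linProc z g) u * z u l)
        ∂(stdGaussian ι) := by
  classical
  have hc := continuous_gibbs_linProc z
  have hz : ∀ u, |z u l| ≤ ∑ u, |z u l| := fun u =>
    Finset.single_le_sum (f := fun u => |z u l|) (fun _ _ => abs_nonneg _) (Finset.mem_univ u)
  have hS : 0 ≤ ∑ u, |z u l| := Finset.sum_nonneg fun _ _ => abs_nonneg _
  refine integral_coord_mul_stdGaussian (C := 1 + 2 * ∑ u, |z u l|) l (hc t).measurable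
    (Continuous.measurable (by fun_prop)) (fun g => ?_) (fun g => ?_) (fun g => ?_)
  · have hd : ∀ u, HasDerivAt (fun x => linProc z (Function.update g l x) u) (z u l) (g l) := by
      intro u
      have h1 : HasDerivAt (fun x => ∑ k, z u k * Function.update g l x k)
          (∑ k, z u k * (if k = l then 1 else 0)) (g l) := by
        refine HasDerivAt.fun_sum fun k _ => HasDerivAt.const_mul _ ?_
        by_cases hk : k = l
        · subst hk; simpa using hasDerivAt_id' (g k)
        · simpa [Function.update_of_ne hk, hk] using hasDerivAt_const (g l) (g k)
      exact h1.congr_deriv (by simp)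
    simpa using hasDerivAt_gibbs hd t
  · rw [abs_of_nonneg (gibbs_nonneg _ _)]
    linarith [gibbs_le_one (linProc z g) t]
  · have h1 : |∑ u, gibbs (linProc z g) u * z u l| ≤ ∑ u, |z u l| := by
      refine (Finset.abs_sum_le_sum_abs _ _).trans (Finset.sum_le_sum fun u _ => ?_)
      rw [abs_mul, abs_of_nonneg (gibbs_nonneg _ _)]
      exact mul_le_of_le_one_left (abs_nonneg _) (gibbs_le_one _ _)
    rw [abs_mul, abs_of_nonneg (gibbs_nonneg _ _)]
    have h2 := abs_sub (z t l) (∑ u, gibbs (linProc z g) u * z u l)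
    calc _ ≤ 1 * |z t l - ∑ u, gibbs (linProc z g) u * z u l| :=
          mul_le_mul_of_nonneg_right (gibbs_le_one _ _) (abs_nonneg _)
      _ ≤ _ := by linarith [hz t]

lemma sum_mul_centered_nonneg {p : τ → ℝ} (hp : ∀ t, 0 ≤ p t) (hp1 : ∑ t, p t = 1)
    {z z' : τ → ι → ℝ} (h : ∀ t u, 0 ≤ ∑ l, (z' t l - z' u l) * (z t l - z u l)) :
    0 ≤ ∑ t, ∑ l, z' t l * (p t * (z t l - ∑ u, p u * z u l)) := by
  have key : ∀ l, ∑ t, z' t l * (p t * (z t l - ∑ u, p u * z u l))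
      = (1 / 2) * ∑ t, ∑ u, p t * p u * ((z' t l - z' u l) * (z t l - z u l)) := by
    intro l
    have e1 : ∑ t, z' t l * (p t * (z t l - ∑ u, p u * z u l))
        = ∑ t, ∑ u, p t * p u * (z' t l * (z t l - z u l)) := by
      refine Finset.sum_congr rfl fun t _ => ?_
      have : z t l - ∑ u, p u * z u l = ∑ u, p u * (z t l - z u l) := by
        simp only [mul_sub, Finset.sum_sub_distrib, ← Finset.sum_mul, hp1, one_mul]
      rw [this, Finset.mul_sum, Finset.mul_sum]
      exact Finset.sum_congr rfl fun u _ => by ring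
    have e2 : ∑ t, ∑ u, p t * p u * (z' t l * (z t l - z u l))
        = ∑ t, ∑ u, p t * p u * (-z' u l * (z t l - z u l)) := by
      rw [Finset.sum_comm]
      exact Finset.sum_congr rfl fun u _ => Finset.sum_congr rfl fun t _ => by ring
    have e3 : ∑ t, ∑ u, p t * p u * ((z' t l - z' u l) * (z t l - z u l))
        = ∑ t, ∑ u, p t * p u * (z' t l * (z t l - z u l))
          + ∑ t, ∑ u, p t * p u * (-z' u l * (z t l - z u l)) := by
      simp only [← Finset.sum_add_distrib]
      exact Finset.sum_congr rfl fun u _ => Finset.sum_congr rfl fun t _ => by ring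
    rw [e1, e3, ← e2]; ring
  rw [Finset.sum_comm, Finset.sum_congr rfl fun l _ => key l, ← Finset.mul_sum, Finset.sum_comm]
  refine mul_nonneg (by norm_num) (Finset.sum_nonneg fun t _ => ?_)
  rw [Finset.sum_comm]
  refine Finset.sum_nonneg fun u _ => ?_
  rw [← Finset.mul_sum]
  exact mul_nonneg (mul_nonneg (hp t) (hp u)) (h t u)

/-- Slepian–Fernique comparison for the log-sum-exp of two orthogonal linear processes. -/
lemma integral_logSumExp_le_of_orthogonal [Nonempty τ] {x y : τ → ι → ℝ}
    (hxy : ∀ t u, ∑ l, x t l * y u l = 0)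
    (h : ∀ t u, ∑ l, (x t l - x u l) ^ 2 ≤ ∑ l, (y t l - y u l) ^ 2) :
    ∫ g, logSumExp (linProc x g) ∂(stdGaussian ι) ≤
      ∫ g, logSumExp (linProc y g) ∂(stdGaussian ι) := by
  set z : ℝ → τ → ι → ℝ := fun θ t l => Real.cos θ * x t l + Real.sin θ * y t l with hz
  set z' : ℝ → τ → ι → ℝ := fun θ t l => -Real.sin θ * x t l + Real.cos θ * y t l with hz'
  set F : ℝ → ℝ := fun θ => ∫ g, logSumExp (linProc (z θ) g) ∂(stdGaussian ι) with hF
  have hlin : ∀ g t θ, HasDerivAt (fun θ => linProc (z θ) g t) (linProc (z' θ) g t) θ := by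
    intro g t θ
    refine HasDerivAt.fun_sum fun l _ => HasDerivAt.mul_const ?_ _
    exact ((Real.hasDerivAt_cos θ).mul_const _).add ((Real.hasDerivAt_sin θ).mul_const _)
  set B : ℝ := ∑ t, ∑ l, (|x t l| + |y t l|) with hB
  have hz'B : ∀ θ t l, |z' θ t l| ≤ B := by
    intro θ t l
    have h1 : |x t l| + |y t l| ≤ B :=
      (Finset.single_le_sum (f := fun l => |x t l| + |y t l|) (fun _ _ => by positivity)
        (Finset.mem_univ l)).trans
      (Finset.single_le_sum (f := fun t => ∑ l, (|x t l| + |y t l|))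
        (fun _ _ => Finset.sum_nonneg fun _ _ => by positivity) (Finset.mem_univ t))
    refine le_trans ?_ h1
    refine (abs_add_le _ _).trans (add_le_add ?_ ?_)
    · rw [abs_mul, abs_neg]
      exact mul_le_of_le_one_left (abs_nonneg _) (Real.abs_sin_le_one _)
    · rw [abs_mul]
      exact mul_le_of_le_one_left (abs_nonneg _) (Real.abs_cos_le_one _)
  have hderiv : ∀ θ, HasDerivAt F
      (∫ g, ∑ t, gibbs (linProc (z θ) g) t * linProc (z' θ) g t ∂(stdGaussian ι)) θ := by
    intro θ
    refine (hasDerivAt_integral_of_dominated_loc_of_deriv_le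
      (F' := fun θ g => ∑ t, gibbs (linProc (z θ) g) t * linProc (z' θ) g t)
      (bound := fun g => ∑ _t : τ, ∑ l, B * |g l|) Filter.univ_mem
      (Filter.Eventually.of_forall fun θ =>
        (continuous_logSumExp_linProc (z θ)).aestronglyMeasurable)
      (integrable_logSumExp_linProc _) ?_ (Filter.Eventually.of_forall fun g θ _ => ?_) ?_
      (Filter.Eventually.of_forall fun g θ _ => hasDerivAt_logSumExp fun t => hlin g t θ)).2
    · have := continuous_gibbs_linProc (z θ)
      exact Continuous.aestronglyMeasurable (by fun_prop)
    · refine (Finset.abs_sum_le_sum_abs _ _).trans (Finset.sum_le_sum fun t _ => ?_)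
      rw [abs_mul, abs_of_nonneg (gibbs_nonneg _ _)]
      exact (mul_le_of_le_one_left (abs_nonneg _) (gibbs_le_one _ _)).trans
        (abs_linProc_le _ _ _ (hz'B θ t))
    · exact integrable_finsetSum _ fun t _ => integrable_finsetSum _ fun l _ =>
        (integrable_coord_stdGaussian l).abs.const_mul _
  have hnonneg : ∀ θ ∈ Set.Icc 0 (Real.pi / 2),
      0 ≤ ∫ g, ∑ t, gibbs (linProc (z θ) g) t * linProc (z' θ) g t ∂(stdGaussian ι) := by
    intro θ hθ
    have hcg := continuous_gibbs_linProc (z θ)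
    have hbdd : ∀ t, ∀ᵐ g ∂(stdGaussian ι), ‖gibbs (linProc (z θ) g) t‖ ≤ 1 := fun t =>
      Filter.Eventually.of_forall fun g => by
        rw [Real.norm_of_nonneg (gibbs_nonneg _ _)]; exact gibbs_le_one _ _
    have e1 : ∀ g, ∑ t, gibbs (linProc (z θ) g) t * linProc (z' θ) g t
        = ∑ t, ∑ l, z' θ t l * (g l * gibbs (linProc (z θ) g) t) := by
      intro g
      refine Finset.sum_congr rfl fun t _ => ?_
      unfold linProc
      rw [Finset.mul_sum]
      exact Finset.sum_congr rfl fun l _ => by ring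
    have i1 : ∀ t l, Integrable (fun g => z' θ t l * (g l * gibbs (linProc (z θ) g) t))
        (stdGaussian ι) := fun t l =>
      ((integrable_coord_stdGaussian l).mul_bdd (hcg t).aestronglyMeasurable
        (hbdd t)).const_mul _
    have i2 : ∀ t l, Integrable (fun g => z' θ t l * (gibbs (linProc (z θ) g) t *
        (z θ t l - ∑ u, gibbs (linProc (z θ) g) u * z θ u l))) (stdGaussian ι) := by
      intro t l
      refine (Integrable.bdd_mul (c := 1) (Integrable.sub (integrable_const _)
        (integrable_finsetSum _ fun u _ => ?_)) (hcg t).aestronglyMeasurable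
        (hbdd t)).const_mul _
      exact (Integrable.of_bound (hcg u).aestronglyMeasurable 1 (hbdd u)).mul_const _
    simp only [e1]
    rw [integral_finsetSum _ fun t _ => integrable_finsetSum _ fun l _ => i1 t l]
    simp_rw [integral_finsetSum _ fun l _ => i1 _ l, integral_const_mul,
      integral_coord_mul_gibbs, ← integral_const_mul, ← integral_finsetSum _ fun l _ => i2 _ l]
    rw [← integral_finsetSum _ fun t _ => integrable_finsetSum _ fun l _ => i2 t l]
    refine integral_nonneg fun g => ?_
    refine sum_mul_centered_nonneg (gibbs_nonneg _) (sum_gibbs _) fun t u => ?_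
    have e : ∑ l, (z' θ t l - z' θ u l) * (z θ t l - z θ u l)
        = Real.sin θ * Real.cos θ *
            (∑ l, (y t l - y u l) ^ 2 - ∑ l, (x t l - x u l) ^ 2)
          + (Real.cos θ ^ 2 - Real.sin θ ^ 2) * (∑ l, x t l * y t l - ∑ l, x t l * y u l
            - ∑ l, x u l * y t l + ∑ l, x u l * y u l) := by
      simp only [← Finset.sum_sub_distrib, ← Finset.sum_add_distrib, Finset.mul_sum]
      exact Finset.sum_congr rfl fun l _ => by simp only [hz, hz']; ring
    rw [e]
    simp only [hxy, sub_zero, add_zero, mul_zero]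
    have s0 : 0 ≤ Real.sin θ :=
      Real.sin_nonneg_of_nonneg_of_le_pi hθ.1 (by linarith [hθ.2, Real.pi_pos])
    have c0 : 0 ≤ Real.cos θ :=
      Real.cos_nonneg_of_neg_pi_div_two_le_of_le (by linarith [hθ.1, Real.pi_pos]) hθ.2
    exact mul_nonneg (mul_nonneg s0 c0) (sub_nonneg.2 (h t u))
  have hmono : MonotoneOn F (Set.Icc 0 (Real.pi / 2)) := by
    refine monotoneOn_of_deriv_nonneg (convex_Icc _ _)
      (fun θ _ => (hderiv θ).continuousAt.continuousWithinAt)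
      (fun θ _ => (hderiv θ).differentiableAt.differentiableWithinAt) fun θ hθ => ?_
    rw [(hderiv θ).deriv]
    exact hnonneg θ (interior_subset hθ)
  have hpi : (0 : ℝ) ≤ Real.pi / 2 := by positivity
  have := hmono (Set.left_mem_Icc.2 hpi) (Set.right_mem_Icc.2 hpi) hpi
  simpa [hF, hz] using this

lemma measurePreserving_comp_stdGaussian {κ : Type*} [Fintype κ] {e : κ → ι}
    (he : Function.Injective e) :
    MeasurePreserving (fun g : ι → ℝ => g ∘ e) (stdGaussian ι) (stdGaussian κ) := by
  have h1 : iIndepFun (fun (i : ι) (g : ι → ℝ) => g i) (stdGaussian ι) :=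
    iIndepFun_pi (X := fun _ => id) (fun _ => aemeasurable_id)
  have h2 := (iIndepFun_iff_map_fun_eq_pi_map
    (fun k => (measurable_pi_apply (e k)).aemeasurable)).1 (h1.precomp he)
  refine ⟨measurable_pi_iff.2 fun k => measurable_pi_apply _, ?_⟩
  have h3 : ∀ k, Measure.map (fun g : ι → ℝ => g (e k)) (stdGaussian ι) = gaussianReal 0 1 :=
    fun k => (measurePreserving_eval (fun _ : ι => gaussianReal 0 1) (e k)).map_eq
  simp only [Function.comp_def, h3] at h2 ⊢
  exact h2

lemma continuous_iSup_linProc [Nonempty τ] (x : τ → ι → ℝ) :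
    Continuous fun g => ⨆ t, linProc x g t := by
  have := Continuous.finset_sup'_apply (s := (Finset.univ : Finset τ)) Finset.univ_nonempty
    (f := fun t g => linProc x g t) fun t _ => continuous_linProc x t
  simpa only [Finset.sup'_univ_eq_ciSup] using this

lemma integrable_iSup_linProc [Nonempty τ] (x : τ → ι → ℝ) :
    Integrable (fun g => ⨆ t, linProc x g t) (stdGaussian ι) := by
  have hi : Integrable (fun g => ∑ t, |linProc x g t|) (stdGaussian ι) :=
    integrable_finsetSum _ fun t _ => Integrable.abs <|
      integrable_finsetSum _ fun l _ => (integrable_coord_stdGaussian l).const_mul _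
  refine hi.mono' (continuous_iSup_linProc x).aestronglyMeasurable
    (Filter.Eventually.of_forall fun g => ?_)
  have hz : ∀ t, |linProc x g t| ≤ ∑ t, |linProc x g t| := fun t =>
    Finset.single_le_sum (f := fun t => |linProc x g t|) (fun _ _ => abs_nonneg _)
      (Finset.mem_univ t)
  rw [Real.norm_eq_abs, abs_le]
  constructor
  · obtain ⟨t⟩ := ‹Nonempty τ›
    have := le_ciSup (Set.finite_range fun t => linProc x g t).bddAbove t
    linarith [abs_le.1 (hz t)]
  · exact ciSup_le fun t => (le_abs_self _).trans (hz t)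

/-- **Slepian–Fernique inequality** for finite linear Gaussian processes, with the majorizing
process bounded by an integrable function. -/
theorem integral_iSup_linProc_le {κ : Type*} [Fintype κ] [Nonempty τ] {x : τ → ι → ℝ}
    {y : τ → κ → ℝ}
    (h : ∀ t u, ∑ l, (x t l - x u l) ^ 2 ≤ ∑ k, (y t k - y u k) ^ 2)
    {Ψ : (κ → ℝ) → ℝ} (hΨ : Integrable Ψ (stdGaussian κ))
    (hyΨ : ∀ g t, linProc y g t ≤ Ψ g) :
    ∫ g, (⨆ t, linProc x g t) ∂(stdGaussian ι) ≤ ∫ g, Ψ g ∂(stdGaussian κ) := by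
  have hl : 0 ≤ Real.log (Fintype.card τ) := Real.log_natCast_nonneg _
  have key : ∀ β : ℝ, 0 < β → ∫ g, (⨆ t, linProc x g t) ∂(stdGaussian ι) ≤
      ∫ g, Ψ g ∂(stdGaussian κ) + Real.log (Fintype.card τ) / β := by
    intro β hβ
    set X : τ → ι ⊕ κ → ℝ := fun t => Sum.elim (fun l => β * x t l) 0 with hX
    set Y : τ → ι ⊕ κ → ℝ := fun t => Sum.elim 0 (fun k => β * y t k) with hY
    have hcmp := integral_logSumExp_le_of_orthogonal (x := X) (y := Y)
      (fun t u => by simp [hX, hY]) (fun t u => by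
        simp only [hX, hY, Fintype.sum_sum_type, Sum.elim_inl, Sum.elim_inr, Pi.zero_apply,
          sub_self, ← mul_sub, mul_pow, ← Finset.mul_sum]
        simpa using mul_le_mul_of_nonneg_left (h t u) (sq_nonneg β))
    have mX := measurePreserving_comp_stdGaussian (ι := ι ⊕ κ) (e := Sum.inl) Sum.inl_injective
    have mY := measurePreserving_comp_stdGaussian (ι := ι ⊕ κ) (e := Sum.inr) Sum.inr_injective
    have hXl : ∀ g : ι ⊕ κ → ℝ, ∀ t, linProc X g t = β * linProc x (g ∘ Sum.inl) t := by
      intro g t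
      simp [linProc, hX, Finset.mul_sum, mul_assoc]
    have hYl : ∀ g : ι ⊕ κ → ℝ, ∀ t, linProc Y g t = β * linProc y (g ∘ Sum.inr) t := by
      intro g t
      simp [linProc, hY, Finset.mul_sum, mul_assoc]
    have hsupc := continuous_iSup_linProc x
    have hΨ' : Integrable (fun g : ι ⊕ κ → ℝ => Ψ (g ∘ Sum.inr)) (stdGaussian (ι ⊕ κ)) :=
      mY.integrable_comp_of_integrable hΨ
    calc ∫ g, (⨆ t, linProc x g t) ∂(stdGaussian ι)
        = ∫ g : ι ⊕ κ → ℝ, (⨆ t, linProc x (g ∘ Sum.inl) t) ∂(stdGaussian (ι ⊕ κ)) := by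
          rw [← mX.map_eq, integral_map mX.aemeasurable hsupc.aestronglyMeasurable]
      _ ≤ ∫ g, logSumExp (linProc X g) / β ∂(stdGaussian (ι ⊕ κ)) := by
          refine integral_mono_ae ?_ ((integrable_logSumExp_linProc X).div_const β)
            (Filter.Eventually.of_forall fun g => ?_)
          · exact mX.integrable_comp_of_integrable (integrable_iSup_linProc x)
          · refine ciSup_le fun t => ?_
            rw [le_div_iff₀ hβ, mul_comm, ← hXl]
            exact le_logSumExp _ t
      _ ≤ ∫ g, logSumExp (linProc Y g) / β ∂(stdGaussian (ι ⊕ κ)) := by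
          rw [integral_div, integral_div]
          exact div_le_div_of_nonneg_right hcmp hβ.le
      _ ≤ ∫ g : ι ⊕ κ → ℝ, (Ψ (g ∘ Sum.inr) + Real.log (Fintype.card τ) / β)
            ∂(stdGaussian (ι ⊕ κ)) := by
          refine integral_mono ((integrable_logSumExp_linProc Y).div_const β)
            (hΨ'.add (integrable_const _)) fun g => ?_
          have := logSumExp_le (z := linProc Y g) (c := β * Ψ (g ∘ Sum.inr)) fun t => by
            rw [hYl]; exact mul_le_mul_of_nonneg_left (hyΨ _ t) hβ.le
          calc _ ≤ _ := div_le_div_of_nonneg_right this hβ.le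
            _ = _ := by field_simp
      _ = _ := by
          rw [integral_add hΨ' (integrable_const _), ← mY.map_eq,
            integral_map mY.aemeasurable (by rw [mY.map_eq]; exact hΨ.1)]
          simp
  refine le_of_forall_pos_le_add fun ε hε => ?_
  refine (key ((Real.log (Fintype.card τ) + 1) / ε) (by positivity)).trans ?_
  gcongr
  rw [div_div_eq_mul_div, div_le_iff₀ (by positivity)]
  nlinarith

end SudakovFernique

section GaussianMoments

lemma integrable_pow_mul_exp_gaussianReal :
    Integrable (fun x : ℝ => Real.exp 1 * ((1 + x ^ 4) * Real.exp (x ^ 2 / 4)))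
      (gaussianReal 0 1) := by
  rw [gaussianReal_of_var_ne_zero _ one_ne_zero, gaussianPDF_def,
    integrable_withDensity_iff_integrable_smul₀' (by fun_prop)
      (Filter.Eventually.of_forall fun _ => ENNReal.ofReal_lt_top)]
  have h0 : Integrable (fun x : ℝ => Real.exp (-(1 / 4) * x ^ 2)) :=
    integrable_exp_neg_mul_sq (by norm_num)
  have h4 : Integrable (fun x : ℝ => x ^ (4 : ℝ) * Real.exp (-(1 / 4) * x ^ 2)) :=
    integrable_rpow_mul_exp_neg_mul_sq (by norm_num) (by norm_num)
  refine ((h0.add h4).const_mul ((√(2 * Real.pi))⁻¹ * Real.exp 1)).congr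
    (Filter.Eventually.of_forall fun x => ?_)
  simp only [Pi.add_apply, smul_eq_mul]
  rw [ENNReal.toReal_ofReal (gaussianPDFReal_nonneg _ _ _), gaussianPDFReal]
  have e : Real.exp (-(1 / 4) * x ^ 2) = Real.exp (-x ^ 2 / 2) * Real.exp (x ^ 2 / 4) := by
    rw [← Real.exp_add]; congr 1; ring
  have e' : x ^ (4 : ℝ) = x ^ 4 := by exact_mod_cast Real.rpow_natCast x 4
  simp only [e, e', sub_zero, NNReal.coe_one, mul_one]
  ring

/-- A numerical constant controlling Gaussian moments. -/
def gaussConst : ℝ :=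
  ∫ x : ℝ, Real.exp 1 * ((1 + x ^ 4) * Real.exp (x ^ 2 / 4)) ∂(gaussianReal 0 1)

lemma gaussConst_nonneg : 0 ≤ gaussConst := integral_nonneg fun x => by positivity

lemma one_add_mul_rpow_pow_le {q : ℝ} (hq : 2 ≤ q) (hq4 : q ≤ 4) {k : ℕ} (hk : 1 ≤ k) {v : ℝ}
    (hv0 : 0 ≤ v) (hv : v * (32 * (k : ℝ) ^ (1 + q / 2)) ≤ 1) (x : ℝ) :
    (1 + v * |x| ^ q) ^ k ≤ Real.exp 1 * Real.exp (x ^ 2 / 4) := by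
  have hk0 : (0 : ℝ) < k := by exact_mod_cast hk
  have hk1 : (1 : ℝ) ≤ k := by exact_mod_cast hk
  set z : ℝ := x ^ 2 / k with hz
  have hz0 : 0 ≤ z := by positivity
  have hx : |x| ^ q = (k : ℝ) ^ (q / 2) * z ^ (q / 2) := by
    rw [← Real.mul_rpow hk0.le hz0, hz, mul_div_cancel₀ _ hk0.ne', ← sq_abs,
      ← Real.rpow_natCast, ← Real.rpow_mul (abs_nonneg x)]
    congr 1; push_cast; ring
  have hv' : v * |x| ^ q ≤ z ^ (q / 2) / (32 * k) := by
    rw [le_div_iff₀ (by positivity), hx]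
    rw [Real.rpow_add hk0, Real.rpow_one] at hv
    have hzq : 0 ≤ z ^ (q / 2) := by positivity
    nlinarith [mul_le_mul_of_nonneg_right hv hzq]
  have main : 1 + v * |x| ^ q ≤ Real.exp (1 / k) * Real.exp (z / 4) := by
    rcases le_total z 1 with h | h
    · have h1 : z ^ (q / 2) ≤ 1 := Real.rpow_le_one hz0 h (by linarith)
      have h2 : z ^ (q / 2) / (32 * k) ≤ 1 / k := by
        rw [div_le_div_iff₀ (by positivity) hk0]; nlinarith
      have h3 := Real.add_one_le_exp (1 / (k : ℝ))
      have h4 : 1 ≤ Real.exp (z / 4) := Real.one_le_exp (by positivity)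
      nlinarith [Real.exp_pos (1 / (k : ℝ))]
    · have h1 : z ^ (q / 2) ≤ z ^ 2 := by
        rw [← Real.rpow_natCast]
        exact Real.rpow_le_rpow_of_exponent_le h (by push_cast; linarith)
      have h2 : z ^ (q / 2) / (32 * k) ≤ z ^ 2 / 32 := by
        rw [div_le_div_iff₀ (by positivity) (by norm_num)]; nlinarith [sq_nonneg z]
      have h3 := Real.quadratic_le_exp_of_nonneg (x := z / 4) (by positivity)
      have h4 : 1 ≤ Real.exp (1 / (k : ℝ)) := Real.one_le_exp (by positivity)
      nlinarith [Real.exp_pos (z / 4)]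
  calc _ ≤ (Real.exp (1 / k) * Real.exp (z / 4)) ^ k := pow_le_pow_left₀ (by positivity) main k
    _ = _ := by
      rw [mul_pow, ← Real.exp_nat_mul, ← Real.exp_nat_mul]
      congr 2
      · field_simp
      · rw [hz]; field_simp

lemma rpow_le_one_add_pow_four {q : ℝ} (hq : 0 ≤ q) (hq4 : q ≤ 4) {x : ℝ} (hx : 0 ≤ x) :
    x ^ q ≤ 1 + x ^ 4 := by
  rcases le_total x 1 with h | h
  · have := Real.rpow_le_one hx h hq
    have : 0 ≤ x ^ 4 := by positivity
    linarith
  · have : x ^ q ≤ x ^ ((4 : ℕ) : ℝ) :=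
      Real.rpow_le_rpow_of_exponent_le h (by push_cast; linarith)
    rw [Real.rpow_natCast] at this
    linarith

lemma integrable_one_add_mul_rpow_pow {q : ℝ} (hq : 2 ≤ q) (hq4 : q ≤ 4) {k : ℕ} (hk : 1 ≤ k)
    {v : ℝ} (hv0 : 0 ≤ v) (hv : v * (32 * (k : ℝ) ^ (1 + q / 2)) ≤ 1) :
    Integrable (fun x : ℝ => (1 + v * |x| ^ q) ^ k) (gaussianReal 0 1) := by
  refine integrable_pow_mul_exp_gaussianReal.mono' ?_ (Filter.Eventually.of_forall fun x => ?_)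
  · have : Continuous fun x : ℝ => |x| ^ q :=
      continuous_abs.rpow_const fun _ => Or.inr (by linarith)
    exact Continuous.aestronglyMeasurable (by fun_prop)
  · rw [Real.norm_of_nonneg (by positivity)]
    refine (one_add_mul_rpow_pow_le hq hq4 hk hv0 hv x).trans ?_
    gcongr
    exact le_mul_of_one_le_left (Real.exp_pos _).le (by nlinarith [sq_nonneg (x ^ 2)])

lemma integral_one_add_mul_rpow_pow_le {q : ℝ} (hq : 2 ≤ q) (hq4 : q ≤ 4) {k : ℕ} (hk : 1 ≤ k)
    {v : ℝ} (hv0 : 0 ≤ v) (hv : v * (32 * (k : ℝ) ^ (1 + q / 2)) ≤ 1) :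
    ∫ x : ℝ, (1 + v * |x| ^ q) ^ k ∂(gaussianReal 0 1) ≤ Real.exp (gaussConst * k * v) := by
  have hpt : ∀ x : ℝ, (1 + v * |x| ^ q) ^ k ≤
      1 + k * v * (Real.exp 1 * ((1 + x ^ 4) * Real.exp (x ^ 2 / 4))) := by
    intro x
    set y : ℝ := v * |x| ^ q with hy
    have hy0 : 0 ≤ y := by positivity
    have hyk := one_add_mul_rpow_pow_le hq hq4 hk hv0 hv x
    have hq' := rpow_le_one_add_pow_four (by linarith) hq4 (abs_nonneg x)
    have e4 : |x| ^ 4 = x ^ 4 := by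
      rw [show 4 = 2 * 2 from rfl, pow_mul, pow_mul, sq_abs]
    rw [e4] at hq'
    have hb : 1 + (k : ℝ) * (-y / (1 + y)) ≤ (1 + -y / (1 + y)) ^ k := by
      refine one_add_mul_le_pow ?_ k
      rw [le_div_iff₀ (by positivity)]; linarith
    have e1 : 1 + -y / (1 + y) = (1 + y)⁻¹ := by field_simp; ring
    rw [e1, inv_pow] at hb
    have hP : 0 < (1 + y) ^ k := by positivity
    have h1 : (1 + y) ^ k * (1 - k * y) ≤ 1 := by
      have h2 : (1 - k * y) ≤ ((1 + y) ^ k)⁻¹ := by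
        refine le_trans ?_ hb
        have h3 : y / (1 + y) ≤ y := div_le_self hy0 (by linarith)
        have h4 := mul_le_mul_of_nonneg_left h3 (Nat.cast_nonneg (α := ℝ) k)
        rw [neg_div]; linarith
      calc _ ≤ (1 + y) ^ k * ((1 + y) ^ k)⁻¹ := mul_le_mul_of_nonneg_left h2 hP.le
        _ = 1 := mul_inv_cancel₀ hP.ne'
    have h5 : k * y * (1 + y) ^ k ≤
        k * (v * (1 + x ^ 4)) * (Real.exp 1 * Real.exp (x ^ 2 / 4)) := by
      gcongr
      exact mul_le_mul_of_nonneg_left hq' hv0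
    linarith
  calc _ ≤ ∫ x : ℝ, (1 + k * v * (Real.exp 1 * ((1 + x ^ 4) * Real.exp (x ^ 2 / 4))))
        ∂(gaussianReal 0 1) :=
        integral_mono (integrable_one_add_mul_rpow_pow hq hq4 hk hv0 hv)
          ((integrable_const _).add (integrable_pow_mul_exp_gaussianReal.const_mul _)) hpt
    _ = 1 + k * v * gaussConst := by
        rw [integral_add (integrable_const _) (integrable_pow_mul_exp_gaussianReal.const_mul _),
          integral_const_mul]
        simp [gaussConst]
    _ ≤ _ := by
        have := Real.add_one_le_exp (gaussConst * k * v)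
        linarith

lemma one_add_sum_le_prod_one_add {ι : Type*} (s : Finset ι) {x : ι → ℝ} (hx : ∀ i, 0 ≤ x i) :
    1 + ∑ i ∈ s, x i ≤ ∏ i ∈ s, (1 + x i) := by
  classical
  induction s using Finset.induction_on with
  | empty => simp
  | insert i s hi ih =>
    rw [Finset.sum_insert hi, Finset.prod_insert hi]
    have : 0 ≤ ∑ i ∈ s, x i := Finset.sum_nonneg fun i _ => hx i
    nlinarith [hx i, mul_le_mul_of_nonneg_left ih (by linarith [hx i] : 0 ≤ 1 + x i),
      mul_nonneg (hx i) this]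

variable {ι κ : Type*} [Fintype ι] [Fintype κ]

lemma integrable_one_add_sum_rpow_pow {q : ℝ} (hq : 2 ≤ q) (hq4 : q ≤ 4) {k : ℕ} (hk : 1 ≤ k)
    {v : ι → ℝ} (hv0 : ∀ i, 0 ≤ v i) (hv : ∀ i, v i * (32 * (k : ℝ) ^ (1 + q / 2)) ≤ 1)
    (hsum : ∑ i, v i ≤ 1) :
    Integrable (fun g : ι → ℝ => (1 + ∑ i, v i * |g i| ^ q) ^ k) (stdGaussian ι) ∧
      ∫ g : ι → ℝ, (1 + ∑ i, v i * |g i| ^ q) ^ k ∂(stdGaussian ι) ≤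
        Real.exp gaussConst ^ k := by
  have hprod : Integrable (fun g : ι → ℝ => ∏ i, (1 + v i * |g i| ^ q) ^ k) (stdGaussian ι) :=
    Integrable.fintype_prod (f := fun i (x : ℝ) => (1 + v i * |x| ^ q) ^ k) fun i =>
      integrable_one_add_mul_rpow_pow hq hq4 hk (hv0 i) (hv i)
  have hle : ∀ g : ι → ℝ, (1 + ∑ i, v i * |g i| ^ q) ^ k ≤ ∏ i, (1 + v i * |g i| ^ q) ^ k := by
    intro g
    have hx : ∀ i, 0 ≤ v i * |g i| ^ q := fun i =>
      mul_nonneg (hv0 i) (Real.rpow_nonneg (abs_nonneg _) _)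
    rw [Finset.prod_pow]
    exact pow_le_pow_left₀ (add_nonneg zero_le_one (Finset.sum_nonneg fun i _ => hx i))
      (one_add_sum_le_prod_one_add _ hx) k
  have hint : Integrable (fun g : ι → ℝ => (1 + ∑ i, v i * |g i| ^ q) ^ k) (stdGaussian ι) := by
    refine hprod.mono' ?_ (Filter.Eventually.of_forall fun g => ?_)
    · have : ∀ i, Continuous fun g : ι → ℝ => |g i| ^ q := fun i =>
        (continuous_apply i).abs.rpow_const fun _ => Or.inr (by linarith)
      exact Continuous.aestronglyMeasurable (by fun_prop)
    · rw [Real.norm_of_nonneg]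
      · exact hle g
      · exact pow_nonneg (add_nonneg zero_le_one (Finset.sum_nonneg fun i _ =>
          mul_nonneg (hv0 i) (Real.rpow_nonneg (abs_nonneg _) _))) _
  refine ⟨hint, (integral_mono hint hprod hle).trans ?_⟩
  have e := integral_fintype_prod_eq_prod (𝕜 := ℝ) (fun i (x : ℝ) => (1 + v i * |x| ^ q) ^ k)
    (μ := fun _ : ι => gaussianReal 0 1)
  rw [_root_.stdGaussian, e]
  calc _ ≤ ∏ i, Real.exp (gaussConst * k * v i) :=
        Finset.prod_le_prod (fun i _ => integral_nonneg fun x => by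
          have := hv0 i
          positivity) fun i _ =>
          integral_one_add_mul_rpow_pow_le hq hq4 hk (hv0 i) (hv i)
    _ = Real.exp (gaussConst * k * ∑ i, v i) := by rw [← Real.exp_sum, Finset.mul_sum]
    _ ≤ Real.exp (k * gaussConst) := by
        rw [Real.exp_le_exp, mul_comm (k : ℝ)]
        exact mul_le_of_le_one_right (mul_nonneg gaussConst_nonneg (Nat.cast_nonneg _)) hsum
    _ = _ := Real.exp_nat_mul _ _

/-- Uniform bound for weighted averages of sums of powers of Gaussians. -/
lemma exists_bound_weighted_rpow {q : ℝ} (hq : 2 ≤ q) (hq4 : q ≤ 4) {k : ℕ} (hk : 1 ≤ k)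
    {v : κ → ι → ℝ} (hv0 : ∀ j i, 0 ≤ v j i)
    (hv : ∀ j i, v j i * (32 * (k : ℝ) ^ (1 + q / 2)) ≤ 1) (hsum : ∀ j, ∑ i, v j i ≤ 1)
    {ω : ℝ} (hω : 0 ≤ ω) (hκ : Fintype.card κ * ω ≤ Real.exp k) :
    ∃ Φ : (ι → ℝ) → ℝ, Integrable Φ (stdGaussian ι) ∧
      ∫ g, Φ g ∂(stdGaussian ι) ≤ 2 * Real.exp (gaussConst + 1) ∧
      ∀ (g : ι → ℝ) (w : κ → ℝ), (∀ j, 0 ≤ w j) → (∀ j, w j ≤ ω) → ∑ j, w j ≤ 1 →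
        ∑ j, w j * ∑ i, v j i * |g i| ^ q ≤ Φ g := by
  set B : ℝ := Real.exp (gaussConst + 1) with hB
  have hB0 : 0 < B := Real.exp_pos _
  set y : κ → (ι → ℝ) → ℝ := fun j g => 1 + ∑ i, v j i * |g i| ^ q with hy
  have hy0 : ∀ j g, 0 ≤ y j g := fun j g => add_nonneg zero_le_one
    (Finset.sum_nonneg fun i _ => mul_nonneg (hv0 j i) (Real.rpow_nonneg (abs_nonneg _) _))
  have hmom := fun j => integrable_one_add_sum_rpow_pow hq hq4 hk (hv0 j) (hv j) (hsum j)
  refine ⟨fun g => B + ω * B * (B ^ k)⁻¹ * ∑ j, y j g ^ k,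
    (integrable_const _).add ((integrable_finsetSum _ fun j _ => (hmom j).1).const_mul _), ?_, ?_⟩
  · rw [integral_add (integrable_const _)
      ((integrable_finsetSum _ fun j _ => (hmom j).1).const_mul _), integral_const_mul,
      integral_finsetSum _ fun j _ => (hmom j).1]
    have h1 : ∑ j, ∫ g, y j g ^ k ∂(stdGaussian ι) ≤
        Fintype.card κ * Real.exp gaussConst ^ k := by
      calc _ ≤ ∑ _j : κ, Real.exp gaussConst ^ k := Finset.sum_le_sum fun j _ => (hmom j).2
        _ = _ := by simp
    have h2 : B ^ k = Real.exp gaussConst ^ k * Real.exp k := by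
      rw [hB, Real.exp_add, mul_pow, Real.exp_one_pow]
    have hE : 0 < Real.exp gaussConst ^ k := by positivity
    calc _ ≤ B + ω * B * (B ^ k)⁻¹ * (Fintype.card κ * Real.exp gaussConst ^ k) := by
          simp only [integral_const, probReal_univ, one_smul]
          gcongr
      _ = B + B * ((Fintype.card κ * ω) / Real.exp k) := by
          rw [h2]; field_simp
      _ ≤ B + B * 1 := by
          gcongr
          exact (div_le_one (Real.exp_pos _)).2 hκ
      _ = _ := by ring
  · intro g w hw0 hwω hw1
    have hpt : ∀ j, ∑ i, v j i * |g i| ^ q ≤ B + B * (B ^ k)⁻¹ * y j g ^ k := by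
      intro j
      have h1 : ∑ i, v j i * |g i| ^ q ≤ y j g := by simp [hy]
      refine h1.trans ?_
      set r : ℝ := y j g / B with hr
      have hr0 : 0 ≤ r := div_nonneg (hy0 j g) hB0.le
      have e : y j g = B * r := by rw [hr]; field_simp
      have h2 : r ≤ 1 + r ^ k := by
        rcases le_total r 1 with h | h
        · have : 0 ≤ r ^ k := by positivity
          linarith
        · have := le_self_pow₀ h (by omega : k ≠ 0)
          linarith
      have h3 : B * (B ^ k)⁻¹ * y j g ^ k = B * r ^ k := by
        rw [e, mul_pow]; field_simp
      rw [h3, e]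
      nlinarith
    have hc : 0 ≤ B * (B ^ k)⁻¹ := by positivity
    calc _ ≤ ∑ j, (B * w j + B * (B ^ k)⁻¹ * (ω * y j g ^ k)) := by
          refine Finset.sum_le_sum fun j _ => ?_
          have h1 := mul_le_mul_of_nonneg_left (hpt j) (hw0 j)
          have h2 := mul_le_mul_of_nonneg_left
            (mul_le_mul_of_nonneg_right (hwω j) (pow_nonneg (hy0 j g) k)) hc
          linarith
      _ = B * ∑ j, w j + ω * B * (B ^ k)⁻¹ * ∑ j, y j g ^ k := by
          rw [Finset.sum_add_distrib, ← Finset.mul_sum, ← Finset.mul_sum, ← Finset.mul_sum]; ring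
      _ ≤ _ := by
          have := mul_le_mul_of_nonneg_left hw1 hB0.le
          linarith

lemma integrable_exp_sum_stdGaussian (c : ι → ℝ) :
    Integrable (fun g : ι → ℝ => Real.exp (∑ i, c i * g i)) (stdGaussian ι) ∧
      ∫ g : ι → ℝ, Real.exp (∑ i, c i * g i) ∂(stdGaussian ι) =
        Real.exp ((∑ i, c i ^ 2) / 2) := by
  simp only [Real.exp_sum]
  constructor
  · exact Integrable.fintype_prod (f := fun i (x : ℝ) => Real.exp (c i * x)) fun i =>
      integrable_exp_mul_gaussianReal (c i)
  · have e := integral_fintype_prod_eq_prod (𝕜 := ℝ) (fun i (x : ℝ) => Real.exp (c i * x))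
      (μ := fun _ : ι => gaussianReal 0 1)
    rw [_root_.stdGaussian, e, Finset.sum_div, Real.exp_sum]
    refine Finset.prod_congr rfl fun i _ => ?_
    have := congrFun (mgf_id_gaussianReal (μ := 0) (v := 1)) (c i)
    simpa [mgf] using this

/-- Uniform bound for weighted averages of absolute values of Gaussian linear forms. -/
lemma exists_bound_weighted_abs {σ ℓ : ℝ} (hσ : 0 < σ) (hℓ : 1 ≤ ℓ)
    {c : κ → ι → ℝ} (hc : ∀ j, ∑ i, c j i ^ 2 ≤ σ ^ 2)
    {ω : ℝ} (hω : 0 ≤ ω) (hκ : Fintype.card κ * ω ≤ Real.exp ℓ) :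
    ∃ Φ : (ι → ℝ) → ℝ, Integrable Φ (stdGaussian ι) ∧
      ∫ g, Φ g ∂(stdGaussian ι) ≤ 4 * (σ * √ℓ) ∧
      ∀ (g : ι → ℝ) (w : κ → ℝ), (∀ j, 0 ≤ w j) → (∀ j, w j ≤ ω) → ∑ j, w j ≤ 1 →
        ∑ j, w j * |∑ i, c j i * g i| ≤ Φ g := by
  have hsq : 0 < √ℓ := Real.sqrt_pos.2 (by linarith)
  have hss : √ℓ * √ℓ = ℓ := Real.mul_self_sqrt (by linarith)
  set lam : ℝ := √ℓ / σ with hlam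
  have hlam0 : 0 < lam := by positivity
  set E : κ → (ι → ℝ) → ℝ := fun j g =>
    Real.exp (∑ i, (lam * c j i) * g i) + Real.exp (∑ i, (-lam * c j i) * g i) with hE
  have hEi : ∀ j, Integrable (E j) (stdGaussian ι) := fun j =>
    (integrable_exp_sum_stdGaussian _).1.add (integrable_exp_sum_stdGaussian _).1
  have hEint : ∀ j, ∫ g, E j g ∂(stdGaussian ι) ≤ 2 * Real.exp (ℓ / 2) := by
    intro j
    have h0 : lam ^ 2 * ∑ i, c j i ^ 2 ≤ ℓ := by
      calc _ ≤ lam ^ 2 * σ ^ 2 := by gcongr; exact hc j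
        _ = ℓ := by rw [hlam]; field_simp; rw [sq, hss]
    have h1 : Real.exp ((∑ i, (lam * c j i) ^ 2) / 2) ≤ Real.exp (ℓ / 2) := by
      simp only [mul_pow, ← Finset.mul_sum]
      gcongr
    rw [hE, integral_add (integrable_exp_sum_stdGaussian _).1 (integrable_exp_sum_stdGaussian _).1,
      (integrable_exp_sum_stdGaussian _).2, (integrable_exp_sum_stdGaussian _).2]
    simp only [neg_mul, neg_sq]
    linarith
  refine ⟨fun g => lam⁻¹ * (2 * ℓ + Real.exp (-(2 * ℓ)) * ω * ∑ j, E j g),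
    ((integrable_const _).add
      ((integrable_finsetSum _ fun j _ => hEi j).const_mul _)).const_mul _, ?_, ?_⟩
  · rw [integral_const_mul, integral_add (integrable_const _)
      ((integrable_finsetSum _ fun j _ => hEi j).const_mul _),
      integral_const_mul (Real.exp (-(2 * ℓ)) * ω),
      integral_finsetSum _ fun j _ => hEi j]
    have h1 : ∑ j, ∫ g, E j g ∂(stdGaussian ι) ≤ Fintype.card κ * (2 * Real.exp (ℓ / 2)) := by
      calc _ ≤ ∑ _j : κ, 2 * Real.exp (ℓ / 2) := Finset.sum_le_sum fun j _ => hEint j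
        _ = _ := by simp
    have h2 : Real.exp (-(2 * ℓ)) * ω * (Fintype.card κ * (2 * Real.exp (ℓ / 2))) ≤ 2 := by
      calc _ = 2 * (Real.exp (-(2 * ℓ)) * Real.exp (ℓ / 2) * (Fintype.card κ * ω)) := by ring
        _ ≤ 2 * (Real.exp (-(2 * ℓ)) * Real.exp (ℓ / 2) * Real.exp ℓ) := by gcongr
        _ = 2 * Real.exp (-(ℓ / 2)) := by
            rw [← Real.exp_add, ← Real.exp_add]; congr 2; ring
        _ ≤ 2 * 1 := by
            gcongr
            exact Real.exp_le_one_iff.2 (by linarith)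
        _ = 2 := by ring
    calc _ ≤ lam⁻¹ * (2 * ℓ + 2) := by
          simp only [integral_const, probReal_univ, one_smul]
          gcongr
          exact (mul_le_mul_of_nonneg_left h1 (by positivity)).trans h2
      _ ≤ lam⁻¹ * (4 * (√ℓ * √ℓ)) := by gcongr; linarith
      _ = _ := by rw [hlam]; field_simp
  · intro g w hw0 hwω hw1
    have hpt : ∀ j, lam * |∑ i, c j i * g i| ≤ 2 * ℓ + Real.exp (-(2 * ℓ)) * E j g := by
      intro j
      have h1 : Real.exp (lam * |∑ i, c j i * g i|) ≤ E j g := by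
        have e1 : ∑ i, (lam * c j i) * g i = lam * ∑ i, c j i * g i := by
          simp [Finset.mul_sum, mul_assoc]
        have e2 : ∑ i, (-lam * c j i) * g i = lam * -∑ i, c j i * g i := by
          simp [Finset.mul_sum, mul_assoc]
        simp only [hE, e1, e2]
        rcases abs_choice (∑ i, c j i * g i) with h | h <;> rw [h]
        · linarith [Real.exp_pos (lam * -∑ i, c j i * g i)]
        · linarith [Real.exp_pos (lam * ∑ i, c j i * g i)]
      have h2 := Real.add_one_le_exp (lam * |∑ i, c j i * g i| - 2 * ℓ)
      rw [sub_eq_add_neg, Real.exp_add] at h2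
      have h3 := mul_le_mul_of_nonneg_right h1 (Real.exp_pos (-(2 * ℓ))).le
      linarith
    beta_reduce
    rw [← div_eq_inv_mul, le_div_iff₀ hlam0]
    calc _ = ∑ j, w j * (lam * |∑ i, c j i * g i|) := by
          rw [Finset.sum_mul]; exact Finset.sum_congr rfl fun j _ => by ring
      _ ≤ ∑ j, (2 * ℓ * w j + Real.exp (-(2 * ℓ)) * (ω * E j g)) := by
          refine Finset.sum_le_sum fun j _ => ?_
          have hE0 : 0 ≤ E j g := by simp only [hE]; positivity
          have h1 := mul_le_mul_of_nonneg_left (hpt j) (hw0 j)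
          have h2 := mul_le_mul_of_nonneg_left (mul_le_mul_of_nonneg_right (hwω j) hE0)
            (Real.exp_pos (-(2 * ℓ))).le
          linarith
      _ = 2 * ℓ * ∑ j, w j + Real.exp (-(2 * ℓ)) * ω * ∑ j, E j g := by
          rw [Finset.sum_add_distrib, ← Finset.mul_sum, ← Finset.mul_sum, ← Finset.mul_sum]; ring
      _ ≤ _ := by
          have := mul_le_mul_of_nonneg_left hw1 (by linarith : 0 ≤ 2 * ℓ)
          linarith

end GaussianMoments

/-! ### The comparison process -/

section Increments

variable {ι κ : Type*} [Fintype ι] [Fintype κ]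

/-- A lower bound for the normalised cross term `-2 s s' A A'` of the comparison process. -/
def crossTerm (s s' t t' : ℝ) : ℝ :=
  if 0 ≤ s * s' then -(s * s') * (t ^ 2 + t' ^ 2) else -2 * (s * s') * |t * t'|

lemma sq_sub_le_add_crossTerm (s s' t t' : ℝ) :
    (s * t - s' * t') ^ 2 + (s ^ 2 - s' ^ 2) * (t ^ 2 - t' ^ 2) / 2 ≤
      (s ^ 2 * t ^ 2 + s' ^ 2 * t' ^ 2 + crossTerm s s' t t') +
        (s ^ 2 * t ^ 2 + s' ^ 2 * t' ^ 2 + crossTerm t t' s s') := by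
  unfold crossTerm
  split_ifs with h1 h2 h2
  · nlinarith [mul_self_nonneg ((s - s') * (t - t'))]
  · rw [abs_of_nonneg h1]
    nlinarith [mul_nonneg (add_nonneg (sq_nonneg t) (sq_nonneg t')) (sq_nonneg (s - s'))]
  · rw [abs_of_nonneg h2]
    nlinarith [mul_nonneg (add_nonneg (sq_nonneg s) (sq_nonneg s')) (sq_nonneg (t - t'))]
  · push Not at h1 h2
    rw [abs_of_neg h1, abs_of_neg h2]
    nlinarith [mul_pos_of_neg_of_neg h1 h2,
      mul_nonneg (add_nonneg (sq_nonneg s) (sq_nonneg s'))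
        (add_nonneg (sq_nonneg t) (sq_nonneg t'))]

lemma sum_crossTerm_le (α : κ → ℝ) (s s' : ℝ) (t t' : κ → ℝ) :
    ∑ j, α j ^ 2 * (s ^ 2 * t j ^ 2 + s' ^ 2 * t' j ^ 2 + crossTerm s s' (t j) (t' j)) ≤
      (s * √(∑ j, α j ^ 2 * t j ^ 2) - s' * √(∑ j, α j ^ 2 * t' j ^ 2)) ^ 2 := by
  set X := ∑ j, α j ^ 2 * t j ^ 2 with hX
  set Y := ∑ j, α j ^ 2 * t' j ^ 2 with hY
  have hX0 : 0 ≤ X := by positivity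
  have hY0 : 0 ≤ Y := by positivity
  have h1 := Real.sq_sqrt hX0
  have h2 := Real.sq_sqrt hY0
  have e : (s * √X - s' * √Y) ^ 2 = s ^ 2 * X + s' ^ 2 * Y - 2 * (s * s') * (√X * √Y) := by
    rw [sub_sq, mul_pow, mul_pow, h1, h2]; ring
  have e2 : ∑ j, α j ^ 2 * (s ^ 2 * t j ^ 2 + s' ^ 2 * t' j ^ 2 + crossTerm s s' (t j) (t' j)) =
      s ^ 2 * X + s' ^ 2 * Y + ∑ j, α j ^ 2 * crossTerm s s' (t j) (t' j) := by
    rw [hX, hY, Finset.mul_sum, Finset.mul_sum, ← Finset.sum_add_distrib,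
      ← Finset.sum_add_distrib]
    exact Finset.sum_congr rfl fun j _ => by ring
  rw [e, e2]
  have key : ∑ j, α j ^ 2 * crossTerm s s' (t j) (t' j) ≤ -2 * (s * s') * (√X * √Y) := by
    unfold crossTerm
    split_ifs with h
    · have e3 : ∑ j, α j ^ 2 * (-(s * s') * (t j ^ 2 + t' j ^ 2)) = -(s * s') * (X + Y) := by
        rw [hX, hY, ← Finset.sum_add_distrib, Finset.mul_sum]
        exact Finset.sum_congr rfl fun j _ => by ring
      rw [e3]
      nlinarith [mul_nonneg h (sq_nonneg (√X - √Y))]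
    · push Not at h
      have e3 : ∑ j, α j ^ 2 * (-2 * (s * s') * |t j * t' j|) =
          -2 * (s * s') * ∑ j, (|α j| * |t j|) * (|α j| * |t' j|) := by
        rw [Finset.mul_sum]
        refine Finset.sum_congr rfl fun j _ => ?_
        rw [abs_mul, ← sq_abs (α j)]; ring
      rw [e3]
      have hcs := Real.sum_mul_le_sqrt_mul_sqrt Finset.univ
        (fun j => |α j| * |t j|) (fun j => |α j| * |t' j|)
      simp only [mul_pow, sq_abs] at hcs
      exact mul_le_mul_of_nonneg_left hcs (by linarith)
  linarith

/-- The increments of the bilinear Gaussian process are dominated by those of a direct sum of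
four simpler processes. -/
lemma bilinear_increment_le (α : ι → κ → ℝ) {c : ℝ} (hc : 0 < c)
    (s s' : ι → ℝ) (t t' : κ → ℝ) :
    ∑ i, ∑ j, α i j ^ 2 * (s i * t j - s' i * t' j) ^ 2 ≤
      ∑ i, (s i * √(∑ j, α i j ^ 2 * t j ^ 2) - s' i * √(∑ j, α i j ^ 2 * t' j ^ 2)) ^ 2 +
      ∑ j, (t j * √(∑ i, α i j ^ 2 * s i ^ 2) - t' j * √(∑ i, α i j ^ 2 * s' i ^ 2)) ^ 2 +
      ∑ j, (∑ i, s i ^ 2 * (α i j ^ 2 / c) - ∑ i, s' i ^ 2 * (α i j ^ 2 / c)) ^ 2 +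
      ∑ j, (c * t j ^ 2 - c * t' j ^ 2) ^ 2 := by
  have h1 : ∑ i, ∑ j, α i j ^ 2 *
      (s i ^ 2 * t j ^ 2 + s' i ^ 2 * t' j ^ 2 + crossTerm (s i) (s' i) (t j) (t' j)) ≤ _ :=
    Finset.sum_le_sum fun i _ => sum_crossTerm_le (α i) (s i) (s' i) t t'
  have h2 : ∑ j, ∑ i, α i j ^ 2 *
      (t j ^ 2 * s i ^ 2 + t' j ^ 2 * s' i ^ 2 + crossTerm (t j) (t' j) (s i) (s' i)) ≤ _ :=
    Finset.sum_le_sum fun j _ => sum_crossTerm_le (fun i => α i j) (t j) (t' j) s s'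
  rw [Finset.sum_comm] at h2
  have h3 : ∑ i, ∑ j, α i j ^ 2 * (s i * t j - s' i * t' j) ^ 2 +
      ∑ i, ∑ j, α i j ^ 2 * ((s i ^ 2 - s' i ^ 2) * (t j ^ 2 - t' j ^ 2) / 2) ≤
      ∑ i, ∑ j, α i j ^ 2 *
      (s i ^ 2 * t j ^ 2 + s' i ^ 2 * t' j ^ 2 + crossTerm (s i) (s' i) (t j) (t' j)) +
      ∑ i, ∑ j, α i j ^ 2 *
      (t j ^ 2 * s i ^ 2 + t' j ^ 2 * s' i ^ 2 + crossTerm (t j) (t' j) (s i) (s' i)) := by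
    simp only [← Finset.sum_add_distrib, ← mul_add]
    refine Finset.sum_le_sum fun i _ => Finset.sum_le_sum fun j _ =>
      mul_le_mul_of_nonneg_left ?_ (sq_nonneg _)
    have := sq_sub_le_add_crossTerm (s i) (s' i) (t j) (t' j)
    linarith
  have h4 : -∑ i, ∑ j, α i j ^ 2 * ((s i ^ 2 - s' i ^ 2) * (t j ^ 2 - t' j ^ 2) / 2) ≤
      ∑ j, (∑ i, s i ^ 2 * (α i j ^ 2 / c) - ∑ i, s' i ^ 2 * (α i j ^ 2 / c)) ^ 2 +
      ∑ j, (c * t j ^ 2 - c * t' j ^ 2) ^ 2 := by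
    rw [Finset.sum_comm, ← Finset.sum_neg_distrib, ← Finset.sum_add_distrib]
    refine Finset.sum_le_sum fun j _ => ?_
    set U := ∑ i, s i ^ 2 * (α i j ^ 2 / c) - ∑ i, s' i ^ 2 * (α i j ^ 2 / c) with hU
    have e : ∑ i, α i j ^ 2 * ((s i ^ 2 - s' i ^ 2) * (t j ^ 2 - t' j ^ 2) / 2) =
        U * (c * t j ^ 2 - c * t' j ^ 2) / 2 := by
      rw [hU, ← Finset.sum_sub_distrib, Finset.sum_mul, Finset.sum_div]
      exact Finset.sum_congr rfl fun i _ => by field_simp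
    rw [e]
    nlinarith [sq_nonneg (U + (c * t j ^ 2 - c * t' j ^ 2)), sq_nonneg U,
      sq_nonneg (c * t j ^ 2 - c * t' j ^ 2)]
  linarith

end Increments

section ProcessBounds

variable {ι κ : Type*} [Fintype ι] [Fintype κ]

lemma one_le_Log (x : ℝ) : 1 ≤ Log x := le_max_left _ _

lemma le_exp_Log {x : ℝ} (hx : 0 ≤ x) : x ≤ Real.exp (Log x) := by
  rcases hx.eq_or_lt with rfl | hx
  · positivity
  · calc x = Real.exp (Real.log x) := (Real.exp_log hx).symm
      _ ≤ _ := Real.exp_le_exp.2 (le_max_right _ _)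

lemma sq_le_rpow_mul_rpow {b r x : ℝ} (hr0 : 0 < r) (hr2 : r ≤ 2) (hx : |x| ≤ b) :
    x ^ 2 ≤ b ^ (2 - r) * |x| ^ r := by
  rcases (abs_nonneg x).eq_or_lt with h | h
  · have : x = 0 := abs_eq_zero.1 h.symm
    subst this
    simp [hr0.ne']
  · calc x ^ 2 = |x| ^ (2 - r) * |x| ^ r := by
          rw [← Real.rpow_add h, sub_add_cancel, Real.rpow_two, sq_abs]
      _ ≤ _ := by
          gcongr

/-- Uniform bound for quadratic-diagonal combinations of Gaussian linear forms. -/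
lemma exists_bound_sum_sq_mul {σ r b : ℝ} (hσ : 0 < σ) (hr0 : 0 < r) (hr2 : r ≤ 2)
    (hb0 : 0 < b) {c : κ → ι → ℝ} (hc : ∀ j, ∑ i, c j i ^ 2 ≤ σ ^ 2) :
    ∃ Φ : (ι → ℝ) → ℝ, Integrable Φ (stdGaussian ι) ∧
      ∫ g, Φ g ∂(stdGaussian ι) ≤
        b ^ (2 - r) * (4 * (σ * √(Log (Fintype.card κ * b ^ r)))) ∧
      ∀ (g : ι → ℝ) (t : κ → ℝ), ∑ j, |t j| ^ r ≤ 1 → (∀ j, |t j| ≤ b) →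
        ∑ j, t j ^ 2 * ∑ i, c j i * g i ≤ Φ g := by
  obtain ⟨Φ, hΦ, hint, hle⟩ := exists_bound_weighted_abs hσ
    (one_le_Log (Fintype.card κ * b ^ r)) hc (ω := b ^ r) (by positivity)
    (le_exp_Log (by positivity))
  refine ⟨fun g => b ^ (2 - r) * Φ g, hΦ.const_mul _, ?_, fun g t h1 h2 => ?_⟩
  · rw [integral_const_mul]
    gcongr
  · calc _ ≤ ∑ j, b ^ (2 - r) * (|t j| ^ r * |∑ i, c j i * g i|) := by
          refine Finset.sum_le_sum fun j _ => ?_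
          rw [← mul_assoc]
          exact (mul_le_mul_of_nonneg_left (le_abs_self _) (sq_nonneg _)).trans
            (mul_le_mul_of_nonneg_right (sq_le_rpow_mul_rpow hr0 hr2 (h2 j)) (abs_nonneg _))
      _ = b ^ (2 - r) * ∑ j, |t j| ^ r * |∑ i, c j i * g i| := by rw [Finset.mul_sum]
      _ ≤ _ := by
          refine mul_le_mul_of_nonneg_left (hle g _ (fun j => by positivity) (fun j => ?_) h1)
            (by positivity)
          exact Real.rpow_le_rpow (abs_nonneg _) (h2 j) hr0.le

/-- Jensen's inequality for sub-probability weights, in square-root form. -/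
lemma sqrt_sum_rpow_le {Q : ℝ} (hQ : 2 ≤ Q) (α w : κ → ℝ) (hw : ∀ j, 0 ≤ w j)
    (hw1 : ∑ j, w j ≤ 1) :
    (√(∑ j, w j * α j ^ 2)) ^ Q ≤ ∑ j, w j * |α j| ^ Q := by
  have h := Real.inner_le_weight_mul_Lp_of_nonneg Finset.univ (p := Q / 2) (by linarith) w
    (fun j => α j ^ 2) hw (fun j => sq_nonneg _)
  have e : ∀ j, (α j ^ 2) ^ (Q / 2) = |α j| ^ Q := by
    intro j
    rw [← sq_abs, ← Real.rpow_two, ← Real.rpow_mul (abs_nonneg _)]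
    congr 1; ring
  simp only [e] at h
  have hS : 0 ≤ ∑ j, w j * |α j| ^ Q :=
    Finset.sum_nonneg fun j _ => mul_nonneg (hw j) (by positivity)
  have hS2 : 0 ≤ ∑ j, w j * α j ^ 2 :=
    Finset.sum_nonneg fun j _ => mul_nonneg (hw j) (by positivity)
  have h1 : (∑ j, w j) ^ (1 - (Q / 2)⁻¹) ≤ 1 := by
    refine Real.rpow_le_one (Finset.sum_nonneg fun j _ => hw j) hw1 ?_
    rw [sub_nonneg]
    exact inv_le_one_of_one_le₀ (by linarith)
  have h2 : ∑ j, w j * α j ^ 2 ≤ (∑ j, w j * |α j| ^ Q) ^ (Q / 2)⁻¹ :=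
    h.trans (mul_le_of_le_one_left (by positivity) h1)
  calc _ = (∑ j, w j * α j ^ 2) ^ (Q / 2) := by
        rw [Real.sqrt_eq_rpow, ← Real.rpow_mul hS2]; congr 1; ring
    _ ≤ ((∑ j, w j * |α j| ^ Q) ^ (Q / 2)⁻¹) ^ (Q / 2) := by gcongr
    _ = _ := Real.rpow_inv_rpow hS (by positivity)

/-- Uniform bound for the "radial" part of the comparison process. -/
lemma exists_bound_radial {Q Q' r b D M : ℝ} (hQ : 2 ≤ Q) (hQ4 : Q < 4)
    (hQQ : Q'.HolderConjugate Q) (hr0 : 0 < r) (hr2 : r ≤ 2) (hb0 : 0 < b) (hb1 : b ≤ 1)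
    (hM : 0 < M) (hD : 0 ≤ D) {α : ι → κ → ℝ} (hα : ∀ i j, |α i j| ≤ M)
    (hcol : ∀ j, ∑ i, |α i j| ^ Q ≤ D ^ Q) :
    ∃ Φ : (ι → ℝ) → ℝ, Integrable Φ (stdGaussian ι) ∧
      ∫ g, Φ g ∂(stdGaussian ι) ≤
        (D + 64 * (b ^ ((2 - r) / 2) * Log (Fintype.card κ * b ^ r) ^ (2 / (4 - Q)) * M)) *
          (1 + 2 * Real.exp (gaussConst + 1)) ∧
      ∀ (g s : ι → ℝ) (t : κ → ℝ), ∑ i, |s i| ^ Q' ≤ 1 → ∑ j, |t j| ^ r ≤ 1 →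
        (∀ j, |t j| ≤ b) → ∑ i, (s i * √(∑ j, α i j ^ 2 * t j ^ 2)) * g i ≤ Φ g := by
  set Λ := Log (Fintype.card κ * b ^ r) with hΛ
  have hΛ1 : 1 ≤ Λ := one_le_Log _
  set k : ℕ := ⌈Λ⌉₊ with hkdef
  have hΛk : Λ ≤ k := Nat.le_ceil _
  have hk1 : (1 : ℝ) ≤ k := hΛ1.trans hΛk
  have hk2 : (k : ℝ) ≤ 2 * Λ := by
    have := Nat.ceil_lt_add_one (show 0 ≤ Λ by linarith)
    linarith
  set R : ℝ := D + 32 * M * k with hR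
  have hR0 : 0 < R := by positivity
  set β : ℝ := b ^ ((2 - r) / 2) with hβ
  have hβ0 : 0 < β := by positivity
  have hβ1 : β ≤ 1 := Real.rpow_le_one hb0.le hb1 (by linarith)
  have hββ : β ^ 2 = b ^ (2 - r) := by
    rw [hβ, ← Real.rpow_natCast, ← Real.rpow_mul hb0.le]; congr 1; push_cast; ring
  have hRQ : 0 < R ^ Q := by positivity
  obtain ⟨Φ, hΦ, hint, hle⟩ := exists_bound_weighted_rpow (ι := ι) (κ := κ) (q := Q) hQ hQ4.le
    (k := k) (by exact_mod_cast hk1) (v := fun j i => |α i j| ^ Q / R ^ Q)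
    (fun j i => by positivity)
    (fun j i => by
      rw [div_mul_eq_mul_div, div_le_one hRQ]
      calc |α i j| ^ Q * (32 * (k : ℝ) ^ (1 + Q / 2))
          ≤ M ^ Q * (32 ^ Q * (k : ℝ) ^ Q) := by
            gcongr
            · exact hα i j
            · calc (32 : ℝ) = 32 ^ (1 : ℝ) := by simp
                _ ≤ 32 ^ Q := Real.rpow_le_rpow_of_exponent_le (by norm_num) (by linarith)
            · linarith
        _ = (32 * M * k) ^ Q := by
            rw [Real.mul_rpow (by positivity) (by positivity),
              Real.mul_rpow (by positivity) (by positivity)]; ring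
        _ ≤ R ^ Q := by
            gcongr
            linarith)
    (fun j => by
      rw [← Finset.sum_div, div_le_one hRQ]
      refine (hcol j).trans ?_
      gcongr
      rw [hR]
      have : 0 < 32 * M * k := by positivity
      linarith)
    (ω := b ^ r) (by positivity)
    ((le_exp_Log (by positivity)).trans (Real.exp_le_exp.2 hΛk))
  refine ⟨fun g => (β * R) * (1 + Φ g), ((integrable_const _).add hΦ).const_mul _, ?_,
    fun g s t hs ht1 ht2 => ?_⟩
  · rw [integral_const_mul, integral_add (integrable_const _) hΦ]
    simp only [integral_const, probReal_univ, one_smul]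
    have h1 : β * R ≤ D + 64 * (β * Λ ^ (2 / (4 - Q)) * M) := by
      have h2 : Λ ≤ Λ ^ (2 / (4 - Q)) := by
        calc Λ = Λ ^ (1 : ℝ) := (Real.rpow_one _).symm
          _ ≤ _ := by
            refine Real.rpow_le_rpow_of_exponent_le hΛ1 ?_
            rw [le_div_iff₀ (by linarith)]; linarith
      have h3 : β * D ≤ D := mul_le_of_le_one_left hD hβ1
      have h4 : β * (32 * M * k) ≤ β * (32 * M * (2 * Λ ^ (2 / (4 - Q)))) := by
        gcongr
        linarith
      rw [hR]
      linarith
    calc _ ≤ (β * R) * (1 + 2 * Real.exp (gaussConst + 1)) := by gcongr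
      _ ≤ _ := mul_le_mul_of_nonneg_right h1 (by positivity)
  · beta_reduce
    have hN : 0 < β * R := by positivity
    have hNQ : 0 < (β * R) ^ Q := by positivity
    set a' : ι → ℝ := fun i => √(∑ j, α i j ^ 2 * t j ^ 2) with ha'
    have hAi : ∀ i, a' i ^ Q ≤ β ^ Q * ∑ j, |t j| ^ r * |α i j| ^ Q := by
      intro i
      have h1 : a' i ≤ β * √(∑ j, |t j| ^ r * α i j ^ 2) := by
        rw [ha', ← Real.sqrt_sq hβ0.le, ← Real.sqrt_mul (sq_nonneg _), hββ, Finset.mul_sum]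
        refine Real.sqrt_le_sqrt (Finset.sum_le_sum fun j _ => ?_)
        have := mul_le_mul_of_nonneg_left (sq_le_rpow_mul_rpow hr0 hr2 (ht2 j))
          (sq_nonneg (α i j))
        linarith
      calc a' i ^ Q ≤ (β * √(∑ j, |t j| ^ r * α i j ^ 2)) ^ Q :=
            Real.rpow_le_rpow (Real.sqrt_nonneg _) h1 (by linarith)
        _ = β ^ Q * (√(∑ j, |t j| ^ r * α i j ^ 2)) ^ Q :=
            Real.mul_rpow hβ0.le (Real.sqrt_nonneg _)
        _ ≤ _ := by
            gcongr
            exact sqrt_sum_rpow_le hQ _ _ (fun j => by positivity) ht1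
    have hterm : ∀ i, (s i * a' i) * g i ≤ (β * R) *
        (|s i| ^ Q' + ∑ j, |t j| ^ r * (|α i j| ^ Q / R ^ Q * |g i| ^ Q)) := by
      intro i
      have ha0 : 0 ≤ a' i := Real.sqrt_nonneg _
      have hy := Real.young_inequality_of_nonneg (abs_nonneg (s i))
        (show 0 ≤ a' i * |g i| / (β * R) by positivity) hQQ
      have hx1 : |s i| ^ Q' / Q' ≤ |s i| ^ Q' := div_le_self (by positivity) hQQ.lt.le
      have hx2 : (a' i * |g i| / (β * R)) ^ Q / Q ≤ (a' i * |g i| / (β * R)) ^ Q :=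
        div_le_self (by positivity) (by linarith)
      have hx3 : (a' i * |g i| / (β * R)) ^ Q ≤
          ∑ j, |t j| ^ r * (|α i j| ^ Q / R ^ Q * |g i| ^ Q) := by
        rw [Real.div_rpow (by positivity) hN.le, Real.mul_rpow ha0 (abs_nonneg _),
          Real.mul_rpow hβ0.le hR0.le]
        calc _ ≤ (β ^ Q * ∑ j, |t j| ^ r * |α i j| ^ Q) * |g i| ^ Q / (β ^ Q * R ^ Q) := by
              gcongr
              exact hAi i
          _ = (∑ j, |t j| ^ r * |α i j| ^ Q) * (|g i| ^ Q / R ^ Q) := by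
              have : 0 < β ^ Q := by positivity
              field_simp
          _ = _ := by
              rw [Finset.sum_mul]
              exact Finset.sum_congr rfl fun j _ => by ring
      calc (s i * a' i) * g i ≤ |s i * a' i * g i| := le_abs_self _
        _ = (β * R) * (|s i| * (a' i * |g i| / (β * R))) := by
            rw [abs_mul, abs_mul, abs_of_nonneg ha0]; field_simp
        _ ≤ _ := mul_le_mul_of_nonneg_left (by linarith) hN.le
    calc _ ≤ ∑ i, (β * R) *
          (|s i| ^ Q' + ∑ j, |t j| ^ r * (|α i j| ^ Q / R ^ Q * |g i| ^ Q)) :=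
          Finset.sum_le_sum fun i _ => hterm i
      _ = (β * R) * (∑ i, |s i| ^ Q' +
          ∑ j, |t j| ^ r * ∑ i, |α i j| ^ Q / R ^ Q * |g i| ^ Q) := by
          rw [← Finset.mul_sum, Finset.sum_add_distrib, Finset.sum_comm]
          simp only [Finset.mul_sum]
      _ ≤ _ := by
          refine mul_le_mul_of_nonneg_left (add_le_add hs ?_) hN.le
          exact hle g _ (fun j => by positivity)
            (fun j => Real.rpow_le_rpow (abs_nonneg _) (ht2 j) hr0.le) ht1

lemma interpolation_le {P D M β Λ : ℝ} (hP : 2 ≤ P) (hP4 : P < 4) (hD : 0 ≤ D) (hM : 0 ≤ M)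
    (hβ0 : 0 < β) (hβ1 : β ≤ 1) (hΛ : 1 ≤ Λ) :
    β ^ 2 * (D ^ (P / 4) * M ^ (1 - P / 4) * √Λ) ≤ D + β * Λ ^ (2 / (4 - P)) * M := by
  set y := β * Λ ^ (2 / (4 - P)) * M with hy
  have hΛ0 : 0 ≤ Λ := by linarith
  have hy0 : 0 ≤ y := by positivity
  have h1 := Real.geom_mean_le_arith_mean2_weighted (w₁ := P / 4) (w₂ := 1 - P / 4)
    (by linarith) (by linarith) hD hy0 (by ring)
  have h2 : y ^ (1 - P / 4) = β ^ (1 - P / 4) * √Λ * M ^ (1 - P / 4) := by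
    rw [hy, Real.mul_rpow (by positivity) hM, Real.mul_rpow hβ0.le (by positivity),
      ← Real.rpow_mul hΛ0, Real.sqrt_eq_rpow]
    congr 3
    have : (4 - P) ≠ 0 := by linarith
    field_simp
    norm_num
  have h3 : β ^ 2 ≤ β ^ (1 - P / 4) := by
    rw [← Real.rpow_two]
    exact Real.rpow_le_rpow_of_exponent_ge hβ0 hβ1 (by linarith)
  calc _ ≤ β ^ (1 - P / 4) * (D ^ (P / 4) * M ^ (1 - P / 4) * √Λ) := by gcongr
    _ = D ^ (P / 4) * y ^ (1 - P / 4) := by rw [h2]; ring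
    _ ≤ P / 4 * D + (1 - P / 4) * y := h1
    _ ≤ D + y := by nlinarith

end ProcessBounds

section FiniteSup

/-- The constant of the main inequality. -/
def slepianConst : ℝ := 80 * (1 + 2 * Real.exp (gaussConst + 1))

lemma slepianConst_pos : 0 < slepianConst := by unfold slepianConst; positivity

lemma _root_.Real.HolderConjugate.left_le_two {r P : ℝ} (h : r.HolderConjugate P) (hP : 2 ≤ P) :
    r ≤ 2 := by
  have h1 := h.inv_add_inv_eq_one
  have h2 : P⁻¹ ≤ 2⁻¹ := inv_anti₀ (by norm_num) hP
  have h3 : (2 : ℝ)⁻¹ ≤ r⁻¹ := by linarith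
  exact (inv_le_inv₀ (by norm_num) h.pos).1 h3

lemma integral_comp_of_measurePreserving {X Y : Type*} [MeasurableSpace X] [MeasurableSpace Y]
    {μ : Measure X} {ν : Measure Y} {f : X → Y} (hf : MeasurePreserving f μ ν) {Φ : Y → ℝ}
    (hΦ : Integrable Φ ν) : ∫ x, (Φ ∘ f) x ∂μ = ∫ y, Φ y ∂ν := by
  have h : AEStronglyMeasurable Φ (Measure.map f μ) := by rw [hf.map_eq]; exact hΦ.1
  rw [← hf.map_eq, integral_map hf.aemeasurable h]
  rfl

variable {ι κ ν τ : Type*} [Fintype ι] [Fintype κ] [Fintype ν] [Fintype τ]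

/-- The finite-supremum form of the main inequality when the row exponent is at most the column
exponent. -/
lemma integral_iSup_bilinear_le [Nonempty τ] {P Q p' q' a b M Dr Dc : ℝ} (hP : 2 ≤ P)
    (hPQ : P ≤ Q) (hQ4 : Q < 4) (hp : p'.HolderConjugate P) (hq : q'.HolderConjugate Q)
    (ha0 : 0 < a) (ha1 : a ≤ 1) (hb0 : 0 < b) (hb1 : b ≤ 1) (hM : 0 < M) (hDr : 0 < Dr)
    (hDc : 0 ≤ Dc) {α : ι → κ → ℝ} (hα : ∀ i j, |α i j| ≤ M)
    (hrow : ∀ i, ∑ j, |α i j| ^ P ≤ Dr ^ P) (hcol : ∀ j, ∑ i, |α i j| ^ Q ≤ Dc ^ Q)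
    {s : τ → ι → ℝ} {t : τ → κ → ℝ} (hs1 : ∀ u, ∑ i, |s u i| ^ q' ≤ 1)
    (hs2 : ∀ u i, |s u i| ≤ a) (ht1 : ∀ u, ∑ j, |t u j| ^ p' ≤ 1) (ht2 : ∀ u j, |t u j| ≤ b)
    {x : τ → ν → ℝ}
    (hx : ∀ u v, ∑ l, (x u l - x v l) ^ 2 =
      ∑ i, ∑ j, α i j ^ 2 * (s u i * t u j - s v i * t v j) ^ 2) :
    ∫ g, (⨆ u, linProc x g u) ∂(stdGaussian ν) ≤ slepianConst * (Dr + Dc +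
      (a ^ ((2 - q') / 2) * Log (Fintype.card ι * a ^ q') ^ (2 / (4 - P)) +
        b ^ ((2 - p') / 2) * Log (Fintype.card κ * b ^ p') ^ (2 / (4 - Q))) * M) := by
  classical
  have hP4 : P < 4 := by linarith
  have hQ : 2 ≤ Q := by linarith
  have hp2 := hp.left_le_two hP
  have hq2 := hq.left_le_two hQ
  set c : ℝ := Dr ^ (P / 4) * M ^ (1 - P / 4) with hc
  have hc0 : 0 < c := by positivity
  have hc4 : c ^ 4 = Dr ^ P * M ^ (4 - P) := by
    rw [hc, mul_pow, ← Real.rpow_natCast, ← Real.rpow_natCast, ← Real.rpow_mul hDr.le,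
      ← Real.rpow_mul hM.le]
    congr 2 <;> push_cast <;> ring
  have hsq4 : ∀ i, ∑ j, (α i j ^ 2 / c) ^ 2 ≤ c ^ 2 := by
    intro i
    have h1 : ∑ j, α i j ^ 4 ≤ c ^ 4 := by
      rw [hc4]
      calc ∑ j, α i j ^ 4 ≤ ∑ j, |α i j| ^ P * M ^ (4 - P) := by
            refine Finset.sum_le_sum fun j _ => ?_
            rcases (abs_nonneg (α i j)).eq_or_lt with h | h
            · rw [abs_eq_zero.1 h.symm, abs_zero, Real.zero_rpow (by linarith)]
              simp
            · calc α i j ^ 4 = |α i j| ^ P * |α i j| ^ (4 - P) := by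
                    rw [← Real.rpow_add h, add_sub_cancel,
                      show (4 : ℝ) = ((4 : ℕ) : ℝ) by norm_num, Real.rpow_natCast]
                    rw [show 4 = 2 * 2 from rfl, pow_mul, pow_mul, sq_abs]
                _ ≤ _ := mul_le_mul_of_nonneg_left
                    (Real.rpow_le_rpow h.le (hα i j) (by linarith)) (by positivity)
        _ = (∑ j, |α i j| ^ P) * M ^ (4 - P) := by rw [Finset.sum_mul]
        _ ≤ _ := by gcongr; exact hrow i
    calc ∑ j, (α i j ^ 2 / c) ^ 2 = (∑ j, α i j ^ 4) / c ^ 2 := by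
          rw [Finset.sum_div]
          exact Finset.sum_congr rfl fun j _ => by rw [div_pow]; ring
      _ ≤ c ^ 4 / c ^ 2 := by gcongr
      _ = c ^ 2 := by field_simp
  obtain ⟨Φ₁, hΦ₁, hi₁, hle₁⟩ := exists_bound_radial hQ hQ4 hq hp.pos hp2 hb0 hb1 hM hDc hα hcol
  obtain ⟨Φ₂, hΦ₂, hi₂, hle₂⟩ := exists_bound_radial (α := fun j i => α i j) hP hP4 hp hq.pos hq2
    ha0 ha1 hM hDr.le (fun j i => hα i j) hrow
  obtain ⟨Φ₃, hΦ₃, hi₃, hle₃⟩ := exists_bound_sum_sq_mul (c := fun i j => α i j ^ 2 / c) hc0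
    hq.pos hq2 ha0 hsq4
  obtain ⟨Φ₄, hΦ₄, hi₄, hle₄⟩ := exists_bound_sum_sq_mul (ι := κ)
    (c := fun j j' => if j = j' then c else 0) hc0 hp.pos hp2 hb0 (fun j => by simp)
  set y : τ → (ι ⊕ κ) ⊕ (κ ⊕ κ) → ℝ := fun u => Sum.elim
    (Sum.elim (fun i => s u i * √(∑ j, α i j ^ 2 * t u j ^ 2))
      (fun j => t u j * √(∑ i, α i j ^ 2 * s u i ^ 2)))
    (Sum.elim (fun j => ∑ i, s u i ^ 2 * (α i j ^ 2 / c)) (fun j => c * t u j ^ 2)) with hy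
  have m₁ := measurePreserving_comp_stdGaussian (ι := (ι ⊕ κ) ⊕ (κ ⊕ κ))
    (e := fun i : ι => Sum.inl (Sum.inl i)) (Sum.inl_injective.comp Sum.inl_injective)
  have m₂ := measurePreserving_comp_stdGaussian (ι := (ι ⊕ κ) ⊕ (κ ⊕ κ))
    (e := fun i : κ => Sum.inl (Sum.inr i)) (Sum.inl_injective.comp Sum.inr_injective)
  have m₃ := measurePreserving_comp_stdGaussian (ι := (ι ⊕ κ) ⊕ (κ ⊕ κ))
    (e := fun i : κ => Sum.inr (Sum.inl i)) (Sum.inr_injective.comp Sum.inl_injective)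
  have m₄ := measurePreserving_comp_stdGaussian (ι := (ι ⊕ κ) ⊕ (κ ⊕ κ))
    (e := fun i : κ => Sum.inr (Sum.inr i)) (Sum.inr_injective.comp Sum.inr_injective)
  have I₁ := m₁.integrable_comp_of_integrable hΦ₁
  have I₂ := m₂.integrable_comp_of_integrable hΦ₂
  have I₃ := m₃.integrable_comp_of_integrable hΦ₃
  have I₄ := m₄.integrable_comp_of_integrable hΦ₄
  have key := integral_iSup_linProc_le (x := x) (y := y) (fun u v => by
    rw [hx]
    refine (bilinear_increment_le α hc0 (s u) (s v) (t u) (t v)).trans (le_of_eq ?_)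
    simp only [hy, Fintype.sum_sum_type, Sum.elim_inl, Sum.elim_inr]
    ring) (((I₁.add I₂).add I₃).add I₄) (fun g u => by
    have h1 := hle₁ (fun i => g (Sum.inl (Sum.inl i))) (s u) (t u) (hs1 u) (ht1 u) (ht2 u)
    have h2 := hle₂ (fun i => g (Sum.inl (Sum.inr i))) (t u) (s u) (ht1 u) (hs1 u) (hs2 u)
    have h3 := hle₃ (fun i => g (Sum.inr (Sum.inl i))) (s u) (hs1 u) (hs2 u)
    have h4 := hle₄ (fun i => g (Sum.inr (Sum.inr i))) (t u) (ht1 u) (ht2 u)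
    have e3 : ∑ i, s u i ^ 2 * ∑ j, α i j ^ 2 / c * g (Sum.inr (Sum.inl j)) =
        ∑ j, (∑ i, s u i ^ 2 * (α i j ^ 2 / c)) * g (Sum.inr (Sum.inl j)) := by
      simp only [Finset.mul_sum, Finset.sum_mul]
      rw [Finset.sum_comm]
      exact Finset.sum_congr rfl fun i _ => Finset.sum_congr rfl fun j _ => by ring
    have e4 : ∑ j, t u j ^ 2 * ∑ j', (if j = j' then c else 0) * g (Sum.inr (Sum.inr j')) =
        ∑ j, c * t u j ^ 2 * g (Sum.inr (Sum.inr j)) := by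
      refine Finset.sum_congr rfl fun j _ => ?_
      simp only [ite_mul, zero_mul, Finset.sum_ite_eq, Finset.mem_univ, if_true]
      ring
    rw [e3] at h3
    rw [e4] at h4
    simp only [linProc, hy, Fintype.sum_sum_type, Sum.elim_inl, Sum.elim_inr, Pi.add_apply,
      Function.comp_def]
    linarith)
  refine key.trans ?_
  rw [integral_add' ((I₁.add I₂).add I₃) I₄, integral_add' (I₁.add I₂) I₃, integral_add' I₁ I₂,
    integral_comp_of_measurePreserving m₁ hΦ₁, integral_comp_of_measurePreserving m₂ hΦ₂,
    integral_comp_of_measurePreserving m₃ hΦ₃, integral_comp_of_measurePreserving m₄ hΦ₄]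
  have hβ : ∀ {z r : ℝ}, 0 < z → (z ^ ((2 - r) / 2)) ^ 2 = z ^ (2 - r) := by
    intro z r hz
    rw [← Real.rpow_natCast, ← Real.rpow_mul hz.le]; congr 1; push_cast; ring
  have g3 := interpolation_le hP hP4 hDr.le hM.le (β := a ^ ((2 - q') / 2)) (by positivity)
    (Real.rpow_le_one ha0.le ha1 (by linarith)) (one_le_Log (Fintype.card ι * a ^ q'))
  have g4 := interpolation_le hP hP4 hDr.le hM.le (β := b ^ ((2 - p') / 2)) (by positivity)
    (Real.rpow_le_one hb0.le hb1 (by linarith)) (one_le_Log (Fintype.card κ * b ^ p'))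
  rw [hβ ha0, ← hc] at g3
  rw [hβ hb0, ← hc] at g4
  have g5 : b ^ ((2 - p') / 2) * Log (Fintype.card κ * b ^ p') ^ (2 / (4 - P)) * M ≤
      b ^ ((2 - p') / 2) * Log (Fintype.card κ * b ^ p') ^ (2 / (4 - Q)) * M := by
    have h1 := Real.rpow_le_rpow_of_exponent_le (one_le_Log (Fintype.card κ * b ^ p'))
      (show 2 / (4 - P) ≤ 2 / (4 - Q) from
        div_le_div_of_nonneg_left (by norm_num) (by linarith) (by linarith))
    gcongr
  have hLa : 0 ≤ Log (Fintype.card ι * a ^ q') := by linarith [one_le_Log (Fintype.card ι * a ^ q')]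
  have hLb : 0 ≤ Log (Fintype.card κ * b ^ p') := by linarith [one_le_Log (Fintype.card κ * b ^ p')]
  set Sa := a ^ ((2 - q') / 2) * Log (Fintype.card ι * a ^ q') ^ (2 / (4 - P)) * M with hSa
  set Sb := b ^ ((2 - p') / 2) * Log (Fintype.card κ * b ^ p') ^ (2 / (4 - Q)) * M with hSb
  have hSa0 : 0 ≤ Sa := by positivity
  have hSb0 : 0 ≤ Sb := by positivity
  set G := 1 + 2 * Real.exp (gaussConst + 1) with hG
  have hG1 : 1 ≤ G := by
    have := Real.exp_pos (gaussConst + 1)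
    linarith
  rw [add_mul _ _ M, ← hSa, ← hSb, slepianConst, ← hG]
  have b1 : Dr ≤ Dr * G := le_mul_of_one_le_right hDr.le hG1
  have b2 : Sa ≤ Sa * G := le_mul_of_one_le_right hSa0 hG1
  have b3 : Sb ≤ Sb * G := le_mul_of_one_le_right hSb0 hG1
  have b4 : 0 ≤ Dc * G := mul_nonneg hDc (by linarith)
  nlinarith

end FiniteSup

section Reduction

variable {ι κ : Type*} [Fintype ι] [Fintype κ]

/-- The coefficient vector of the bilinear Gaussian process at a pair of vectors. -/
def bilinCoeff (α : ι → κ → ℝ) (z : (ι → ℝ) × (κ → ℝ)) (l : ι × κ) : ℝ :=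
  α l.1 l.2 * (z.1 l.1 * z.2 l.2)

lemma abs_mul_sub_mul_le {x y x' y' ε : ℝ} (hy : |y| ≤ 1) (hx' : |x'| ≤ 1)
    (h1 : |x - x'| ≤ ε) (h2 : |y - y'| ≤ ε) : |x * y - x' * y'| ≤ 2 * ε := by
  have e : x * y - x' * y' = (x - x') * y + x' * (y - y') := by ring
  rw [e]
  refine (abs_add_le _ _).trans ?_
  rw [abs_mul, abs_mul]
  have := mul_le_of_le_one_right (abs_nonneg (x - x')) hy
  have := mul_le_of_le_one_left (abs_nonneg (y - y')) hx'
  linarith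

/-- A bound for all finite suprema of the bilinear Gaussian process over a bounded set passes to
the supremum over the whole set. -/
lemma integral_sSup_le_of_finset {S : Set ((ι → ℝ) × (κ → ℝ))} (h0 : 0 ∈ S)
    (hS : ∀ z ∈ S, (∀ i, |z.1 i| ≤ 1) ∧ ∀ j, |z.2 j| ≤ 1) (α : ι → κ → ℝ) {B : ℝ}
    (H : ∀ T : Finset ((ι → ℝ) × (κ → ℝ)), T.Nonempty → (∀ z ∈ T, z ∈ S) →
      ∫ g, (⨆ z : T, linProc (fun z : T => bilinCoeff α z) g z) ∂(stdGaussian (ι × κ)) ≤ B) :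
    ∫ g, sSup {x : ℝ | ∃ z ∈ S, x = ∑ l, bilinCoeff α z l * g l} ∂(stdGaussian (ι × κ)) ≤ B := by
  have hK : Integrable (fun g : ι × κ → ℝ => ∑ l, 2 * |α l.1 l.2| * |g l|)
      (stdGaussian (ι × κ)) :=
    integrable_finsetSum _ fun l _ => (integrable_coord_stdGaussian l).abs.const_mul _
  set K : ℝ := ∫ g : ι × κ → ℝ, ∑ l, 2 * |α l.1 l.2| * |g l| ∂(stdGaussian (ι × κ)) with hKdef
  have hbdd : TotallyBounded S := by
    have h1 : S ⊆ Metric.closedBall 0 1 := by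
      intro z hz
      rw [mem_closedBall_zero_iff, norm_prod_le_iff]
      exact ⟨(pi_norm_le_iff_of_nonneg zero_le_one).2 (hS z hz).1,
        (pi_norm_le_iff_of_nonneg zero_le_one).2 (hS z hz).2⟩
    exact (isCompact_closedBall _ _).totallyBounded.subset h1
  have key : ∀ ε : ℝ, 0 < ε →
      ∫ g, sSup {x : ℝ | ∃ z ∈ S, x = ∑ l, bilinCoeff α z l * g l} ∂(stdGaussian (ι × κ)) ≤
        B + ε * K := by
    intro ε hε
    obtain ⟨T, hTS, hTf, hcov⟩ := Metric.finite_approx_of_totallyBounded hbdd ε hε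
    obtain ⟨T, rfl⟩ := hTf.exists_finset_coe
    have hTne : T.Nonempty := by
      have := hcov h0
      simp only [Set.mem_iUnion] at this
      obtain ⟨z, hz, _⟩ := this
      exact ⟨z, hz⟩
    have : Nonempty T := hTne.to_subtype
    have hint := integrable_iSup_linProc (fun z : T => bilinCoeff α z)
    calc _ ≤ ∫ g, ((⨆ z : T, linProc (fun z : T => bilinCoeff α z) g z) +
          ε * ∑ l, 2 * |α l.1 l.2| * |g l|) ∂(stdGaussian (ι × κ)) := by
          refine integral_mono_of_nonneg (Filter.Eventually.of_forall fun g => ?_)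
            (hint.add (hK.const_mul ε)) (Filter.Eventually.of_forall fun g => ?_)
          · exact Real.sSup_nonneg' ⟨0, ⟨0, h0, by simp [bilinCoeff]⟩, le_rfl⟩
          · refine csSup_le ⟨0, ⟨0, h0, by simp [bilinCoeff]⟩⟩ ?_
            rintro _ ⟨z, hz, rfl⟩
            have hz' := hcov hz
            simp only [Set.mem_iUnion] at hz'
            obtain ⟨w, hw, hzw⟩ := hz'
            have hwS := hTS hw
            rw [Metric.mem_ball, dist_eq_norm] at hzw
            have hle := le_ciSup (Set.finite_range fun z : T =>
              linProc (fun z : T => bilinCoeff α z) g z).bddAbove ⟨w, hw⟩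
            have h1 : ∀ i, |z.1 i - w.1 i| ≤ ε := fun i =>
              ((norm_le_pi_norm (z - w).1 i).trans (norm_fst_le _)).trans hzw.le
            have h2 : ∀ j, |z.2 j - w.2 j| ≤ ε := fun j =>
              ((norm_le_pi_norm (z - w).2 j).trans (norm_snd_le _)).trans hzw.le
            have hdiff : ∑ l, bilinCoeff α z l * g l - ∑ l, bilinCoeff α w l * g l ≤
                ε * ∑ l, 2 * |α l.1 l.2| * |g l| := by
              rw [← Finset.sum_sub_distrib, Finset.mul_sum]
              refine Finset.sum_le_sum fun l _ => ?_
              have h3 := abs_mul_sub_mul_le ((hS z hz).2 l.2) ((hS w hwS).1 l.1)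
                (h1 l.1) (h2 l.2)
              calc _ ≤ |bilinCoeff α z l * g l - bilinCoeff α w l * g l| := le_abs_self _
                _ = |α l.1 l.2| * |z.1 l.1 * z.2 l.2 - w.1 l.1 * w.2 l.2| * |g l| := by
                    rw [← abs_mul, ← abs_mul]
                    congr 1
                    simp only [bilinCoeff]; ring
                _ ≤ |α l.1 l.2| * (2 * ε) * |g l| := by gcongr
                _ = _ := by ring
            have e : linProc (fun z : T => bilinCoeff α z) g ⟨w, hw⟩ =
                ∑ l, bilinCoeff α w l * g l := rfl
            linarith
      _ = (∫ g, (⨆ z : T, linProc (fun z : T => bilinCoeff α z) g z) ∂(stdGaussian (ι × κ))) +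
          ε * K := by
          rw [integral_add hint (hK.const_mul ε), integral_const_mul]
      _ ≤ _ := by
          gcongr
          exact H T hTne fun z hz => hTS hz
  have hK0 : 0 ≤ K := integral_nonneg fun g => by positivity
  refine le_of_forall_pos_le_add fun δ hδ => ?_
  refine (key (δ / (K + 1)) (by positivity)).trans ?_
  have : δ / (K + 1) * K ≤ δ := by
    rw [div_mul_eq_mul_div, div_le_iff₀ (by positivity)]
    nlinarith
  linarith

lemma lpNorm_nonneg (r : ℝ≥0∞) (x : ι → ℝ) : 0 ≤ lpNorm r x := by
  unfold _root_.lpNorm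
  split_ifs
  · exact Real.iSup_nonneg fun i => abs_nonneg _
  · positivity

lemma sum_rpow_eq_lpNorm_rpow {r : ℝ≥0∞} (hr : 0 < r.toReal) (x : ι → ℝ) :
    ∑ i, |x i| ^ r.toReal = lpNorm r x ^ r.toReal := by
  have hr' : r ≠ ⊤ := by
    rintro rfl
    simp at hr
  rw [_root_.lpNorm, if_neg hr', one_div, Real.rpow_inv_rpow (by positivity) hr.ne']

lemma sum_rpow_le_of_lpNorm_le {r : ℝ≥0∞} (hr : 0 < r.toReal) {x : ι → ℝ} {D : ℝ}
    (h : lpNorm r x ≤ D) : ∑ i, |x i| ^ r.toReal ≤ D ^ r.toReal := by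
  rw [sum_rpow_eq_lpNorm_rpow hr]
  exact Real.rpow_le_rpow (lpNorm_nonneg _ _) h hr.le

lemma abs_le_lpNorm {r : ℝ≥0∞} (hr : 0 < r.toReal) (x : ι → ℝ) (i : ι) : |x i| ≤ lpNorm r x := by
  rw [← Real.rpow_le_rpow_iff (abs_nonneg _) (lpNorm_nonneg _ _) hr,
    ← sum_rpow_eq_lpNorm_rpow hr]
  exact Finset.single_le_sum (f := fun i => |x i| ^ r.toReal) (fun _ _ => by positivity)
    (Finset.mem_univ i)

lemma holderConjugate_toReal {p r : ℝ≥0∞} (h : 1 / p + 1 / r = 1) (hr : 2 ≤ r) (hr4 : r < 4) :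
    2 ≤ r.toReal ∧ r.toReal < 4 ∧ p.toReal.HolderConjugate r.toReal := by
  have hrt : r ≠ ⊤ := (hr4.trans (by simp)).ne
  have h2 : 2 ≤ r.toReal := by
    have := ENNReal.toReal_mono hrt hr
    simpa using this
  have h4 : r.toReal < 4 := by
    have := ENNReal.toReal_strict_mono (by simp) hr4
    simpa using this
  have hc : ENNReal.HolderConjugate p r := by
    rw [ENNReal.holderConjugate_iff]
    simpa using h
  have := hc.symm
  exact ⟨h2, h4, (ENNReal.HolderConjugate.toReal (p := r) (q := p) (by linarith)).symm⟩

end Reduction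

section Matrices

variable {m n : ℕ}

lemma lpNorm_row_le_D1 (r : ℝ≥0∞) (A : Fin m → Fin n → ℝ) (i : Fin m) :
    lpNorm r (fun j => A i j) ≤ D1 r A :=
  le_ciSup (f := fun i => lpNorm r (fun j => A i j)) (Set.finite_range _).bddAbove i

lemma lpNorm_col_le_D2 (r : ℝ≥0∞) (A : Fin m → Fin n → ℝ) (j : Fin n) :
    lpNorm r (fun i => A i j) ≤ D2 r A :=
  le_ciSup (f := fun j => lpNorm r (fun i => A i j)) (Set.finite_range _).bddAbove j

lemma abs_le_maxEntry (A : Fin m → Fin n → ℝ) (i : Fin m) (j : Fin n) :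
    |A i j| ≤ maxEntry A :=
  le_ciSup (f := fun ij : Fin m × Fin n => |A ij.1 ij.2|) (Set.finite_range _).bddAbove (i, j)

lemma maxEntry_nonneg (A : Fin m → Fin n → ℝ) : 0 ≤ maxEntry A :=
  Real.iSup_nonneg fun _ => abs_nonneg _

lemma D1_nonneg (r : ℝ≥0∞) (A : Fin m → Fin n → ℝ) : 0 ≤ D1 r A :=
  Real.iSup_nonneg fun _ => lpNorm_nonneg _ _

lemma D2_nonneg (r : ℝ≥0∞) (A : Fin m → Fin n → ℝ) : 0 ≤ D2 r A :=
  Real.iSup_nonneg fun _ => lpNorm_nonneg _ _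

lemma maxEntry_le_D1 {r : ℝ≥0∞} (hr : 0 < r.toReal) (A : Fin m → Fin n → ℝ) :
    maxEntry A ≤ D1 r A :=
  Real.iSup_le (fun ij => (abs_le_lpNorm hr (fun j => A ij.1 j) ij.2).trans
    (lpNorm_row_le_D1 r A ij.1)) (D1_nonneg _ _)

lemma maxEntry_le_D2 {r : ℝ≥0∞} (hr : 0 < r.toReal) (A : Fin m → Fin n → ℝ) :
    maxEntry A ≤ D2 r A :=
  Real.iSup_le (fun ij => (abs_le_lpNorm hr (fun i => A i ij.2) ij.1).trans
    (lpNorm_col_le_D2 r A ij.2)) (D2_nonneg _ _)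

end Matrices

/-- Statement 19 (Proposition: flat vectors, Slepian–Fernique bound, `p*, q ∈ [2,4)`):
`E sup_{s ∈ B_{q*} ∩ a B_∞, t ∈ B_p ∩ b B_∞} Σ a_{ij} g_{ij} s_i t_j
 ≤ C[D1 + D2 + (a^{(2−q*)/2} Log^{2/(4−p*)}(m a^{q*}) + b^{(2−p)/2} Log^{2/(4−q)}(n b^p)) max|a_{ij}|]`. -/
theorem prop_slepian_flat :
    ∃ C : ℝ, 0 < C ∧
      ∀ p pstar q qstar : ℝ≥0∞,
        1 / p + 1 / pstar = 1 → 1 / q + 1 / qstar = 1 →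
        2 ≤ pstar → pstar < 4 → 2 ≤ q → q < 4 →
        ∀ a b : ℝ, 0 < a → a ≤ 1 → 0 < b → b ≤ 1 →
        ∀ (m n : ℕ), 0 < m → 0 < n → ∀ A : Fin m → Fin n → ℝ,
          (∫ g : Fin m × Fin n → ℝ,
              sSup { x : ℝ | ∃ s : Fin m → ℝ, ∃ t : Fin n → ℝ,
                lpNorm qstar s ≤ 1 ∧ (∀ i, |s i| ≤ a) ∧
                lpNorm p t ≤ 1 ∧ (∀ j, |t j| ≤ b) ∧
                x = ∑ i, ∑ j, A i j * g (i, j) * s i * t j }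
            ∂ stdGaussian (Fin m × Fin n)) ≤
            C * (D1 pstar A + D2 q A +
              (a ^ ((2 - qstar.toReal) / 2) *
                  Log ((m : ℝ) * a ^ qstar.toReal) ^ (2 / (4 - pstar.toReal)) +
                b ^ ((2 - p.toReal) / 2) *
                  Log ((n : ℝ) * b ^ p.toReal) ^ (2 / (4 - q.toReal))) *
                maxEntry A) := by
  refine ⟨slepianConst, slepianConst_pos, ?_⟩
  intro p pstar q qstar hp hq hp2 hp4 hq2 hq4 a b ha0 ha1 hb0 hb1 m n _ _ A
  obtain ⟨hP2, hP4, hpP⟩ := holderConjugate_toReal hp hp2 hp4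
  obtain ⟨hQ2, hQ4, hqQ⟩ := holderConjugate_toReal ((add_comm _ _).trans hq) hq2 hq4
  set S : Set ((Fin m → ℝ) × (Fin n → ℝ)) := {z | lpNorm qstar z.1 ≤ 1 ∧ (∀ i, |z.1 i| ≤ a) ∧
    lpNorm p z.2 ≤ 1 ∧ ∀ j, |z.2 j| ≤ b} with hSdef
  have hset : ∀ g : Fin m × Fin n → ℝ,
      {x : ℝ | ∃ s : Fin m → ℝ, ∃ t : Fin n → ℝ,
        lpNorm qstar s ≤ 1 ∧ (∀ i, |s i| ≤ a) ∧ lpNorm p t ≤ 1 ∧ (∀ j, |t j| ≤ b) ∧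
        x = ∑ i, ∑ j, A i j * g (i, j) * s i * t j} =
      {x : ℝ | ∃ z ∈ S, x = ∑ l, bilinCoeff A z l * g l} := by
    intro g
    have e : ∀ (s : Fin m → ℝ) (t : Fin n → ℝ), ∑ i, ∑ j, A i j * g (i, j) * s i * t j =
        ∑ l, bilinCoeff A (s, t) l * g l := by
      intro s t
      rw [Fintype.sum_prod_type]
      exact Finset.sum_congr rfl fun i _ => Finset.sum_congr rfl fun j _ => by
        simp only [bilinCoeff]; ring
    ext x
    constructor
    · rintro ⟨s, t, h1, h2, h3, h4, rfl⟩
      exact ⟨(s, t), ⟨h1, h2, h3, h4⟩, e s t⟩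
    · rintro ⟨⟨s, t⟩, ⟨h1, h2, h3, h4⟩, rfl⟩
      exact ⟨s, t, h1, h2, h3, h4, (e s t).symm⟩
  simp only [hset]
  have hL : ∀ x y : ℝ, 0 ≤ Log x ^ y := fun x y =>
    Real.rpow_nonneg (zero_le_one.trans (one_le_Log x)) y
  rcases (maxEntry_nonneg A).eq_or_lt with hM | hM
  · have hA : ∀ i j, A i j = 0 := fun i j => abs_nonpos_iff.1 (hM ▸ abs_le_maxEntry A i j)
    have h1 : ∀ g : Fin m × Fin n → ℝ,
        sSup {x : ℝ | ∃ z ∈ S, x = ∑ l, bilinCoeff A z l * g l} ≤ 0 := by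
      intro g
      refine Real.sSup_le ?_ le_rfl
      rintro _ ⟨z, _, rfl⟩
      simp [bilinCoeff, hA]
    refine (integral_nonpos h1).trans ?_
    have := slepianConst_pos
    have := D1_nonneg pstar A
    have := D2_nonneg q A
    rw [← hM, mul_zero, add_zero]
    positivity
  · have hD1 : 0 < D1 pstar A := hM.trans_le (maxEntry_le_D1 (by linarith) A)
    have hD2 : 0 < D2 q A := hM.trans_le (maxEntry_le_D2 (by linarith) A)
    refine integral_sSup_le_of_finset ?_ ?_ A ?_
    · have h0 : ∀ {r : ℝ≥0∞} {k : ℕ}, 0 < r.toReal → lpNorm r (0 : Fin k → ℝ) ≤ 1 := by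
        intro r k hr
        rw [← Real.rpow_le_rpow_iff (lpNorm_nonneg _ _) zero_le_one hr,
          ← sum_rpow_eq_lpNorm_rpow hr]
        simp [hr.ne']
      exact ⟨h0 hqQ.pos, by simp [ha0.le], h0 hpP.pos, by simp [hb0.le]⟩
    · rintro z ⟨_, h2, _, h4⟩
      exact ⟨fun i => (h2 i).trans ha1, fun j => (h4 j).trans hb1⟩
    · intro T hT hTS
      have : Nonempty T := hT.to_subtype
      have hs1 : ∀ u : T, ∑ i, |u.1.1 i| ^ qstar.toReal ≤ 1 := fun u => by
        simpa using sum_rpow_le_of_lpNorm_le hqQ.pos (hTS _ u.2).1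
      have ht1 : ∀ u : T, ∑ j, |u.1.2 j| ^ p.toReal ≤ 1 := fun u => by
        simpa using sum_rpow_le_of_lpNorm_le hpP.pos (hTS _ u.2).2.2.1
      have hrow : ∀ i, ∑ j, |A i j| ^ pstar.toReal ≤ D1 pstar A ^ pstar.toReal := fun i =>
        sum_rpow_le_of_lpNorm_le (by linarith) (lpNorm_row_le_D1 pstar A i)
      have hcol : ∀ j, ∑ i, |A i j| ^ q.toReal ≤ D2 q A ^ q.toReal := fun j =>
        sum_rpow_le_of_lpNorm_le (by linarith) (lpNorm_col_le_D2 q A j)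
      have hx : ∀ u v : T, ∑ l, (bilinCoeff A u l - bilinCoeff A v l) ^ 2 =
          ∑ i, ∑ j, A i j ^ 2 * (u.1.1 i * u.1.2 j - v.1.1 i * v.1.2 j) ^ 2 := by
        intro u v
        rw [Fintype.sum_prod_type]
        exact Finset.sum_congr rfl fun i _ => Finset.sum_congr rfl fun j _ => by
          simp only [bilinCoeff]; ring
      rcases le_total pstar.toReal q.toReal with hPQ | hPQ
      · have := integral_iSup_bilinear_le (x := fun z : T => bilinCoeff A z) hP2 hPQ hQ4 hpP
          hqQ ha0 ha1 hb0 hb1 hM hD1 hD2.le (abs_le_maxEntry A) hrow hcol hs1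
          (fun u => (hTS _ u.2).2.1) ht1 (fun u => (hTS _ u.2).2.2.2) hx
        simpa only [Fintype.card_fin] using this
      · have := integral_iSup_bilinear_le (x := fun z : T => bilinCoeff A z)
          (α := fun j i => A i j) hQ2 hPQ hP4 hqQ
          hpP hb0 hb1 ha0 ha1 hM hD2 hD1.le (fun j i => abs_le_maxEntry A i j) hcol hrow ht1
          (fun u => (hTS _ u.2).2.2.2) hs1 (fun u => (hTS _ u.2).2.1) (fun u v => by
            rw [hx, Finset.sum_comm]
            exact Finset.sum_congr rfl fun i _ => Finset.sum_congr rfl fun j _ => by ring)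
        simp only [Fintype.card_fin] at this
        rw [add_comm (D1 pstar A), add_comm (a ^ _ * _)]
        exact this
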